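/- arXiv:1008.4615 — 2 statements merged into one kernel-verified Lean document; each statement's English description precedes it below -/
import Mathlib

section
/- Suppose λ and μ are partitions with λ ⊑ μ (μ doubly dominates λ) and |μ| = |λ| + 1. Then for every r ≥ 1, 0 ≤ (Σ_{i=1}^r μ_i) − (Σ_{i=1}^r λ_i) ≤ 1. -/
/-- A partition: a weakly decreasing sequence of natural numbers (indexed from 0,
with missing parts treated as 0), having only finitely many nonzero parts. -/
structure YPartition where
  parts : ℕ → ℕ
  antitone : ∀ i j : ℕ, i ≤ j → parts j ≤ parts i
  finite : ∃ N : ℕ, ∀ i : ℕ, N ≤ i → parts i = 0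

/-- Partial sum of the first `r` values of `f` (so `psum lam.parts r = λ_1 + ⋯ + λ_r`). -/
def psum (f : ℕ → ℕ) (r : ℕ) : ℕ := ∑ i ∈ Finset.range r, f i

/-- The parts of the conjugate partition: `λ*_{i+1} = |{j : λ_j ≥ i+1}|` (0-indexed). -/
noncomputable def conjParts (p : YPartition) : ℕ → ℕ :=
  fun i => {j : ℕ | i + 1 ≤ p.parts j}.ncard

/-- The size `|λ| = Σ_i λ_i` of a partition. -/
noncomputable def size (p : YPartition) : ℕ := sSup (Set.range (psum p.parts))

/-- `μ` doubly dominates `lam`: each partial sum of parts of `μ` is at least the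
corresponding one for `lam`, and the same for the conjugates. -/
def DoublyDominates (μ lam : YPartition) : Prop :=
  (∀ r : ℕ, psum lam.parts r ≤ psum μ.parts r) ∧
  (∀ r : ℕ, psum (conjParts lam) r ≤ psum (conjParts μ) r)

/-- The positions in `S` form a union of `k` increasing subsequences of `π`. -/
def IsUnionKIncreasing {n : ℕ} (π : Equiv.Perm (Fin n)) (k : ℕ) (S : Finset (Fin n)) : Prop :=
  ∃ c : Fin n → Fin k, ∀ i ∈ S, ∀ j ∈ S, i < j → c i = c j → π i < π j

/-- The positions in `S` form a union of `k` decreasing subsequences of `π`. -/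
def IsUnionKDecreasing {n : ℕ} (π : Equiv.Perm (Fin n)) (k : ℕ) (S : Finset (Fin n)) : Prop :=
  ∃ c : Fin n → Fin k, ∀ i ∈ S, ∀ j ∈ S, i < j → c i = c j → π j < π i

/-- `I_k(π)`: the maximum size of a set of positions of `π` that is a union of `k`
increasing subsequences. -/
noncomputable def incMax {n : ℕ} (π : Equiv.Perm (Fin n)) (k : ℕ) : ℕ :=
  sSup {m : ℕ | ∃ S : Finset (Fin n), IsUnionKIncreasing π k S ∧ S.card = m}

/-- `D_k(π)`: the maximum size of a set of positions of `π` that is a union of `k`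
decreasing subsequences. -/
noncomputable def decMax {n : ℕ} (π : Equiv.Perm (Fin n)) (k : ℕ) : ℕ :=
  sSup {m : ℕ | ∃ S : Finset (Fin n), IsUnionKDecreasing π k S ∧ S.card = m}

/-- `σ` is involved in `π` (`σ ≼ π`): some subsequence of the values of `π` is in the
same relative order as the values of `σ`. -/
def Involved {m n : ℕ} (σ : Equiv.Perm (Fin m)) (π : Equiv.Perm (Fin n)) : Prop :=
  ∃ f : Fin m → Fin n, StrictMono f ∧ ∀ i j : Fin m, σ i < σ j ↔ π (f i) < π (f j)

/-- `π` has RSK shape `lam`, characterized via Greene's theorem: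
`λ_1 + ⋯ + λ_k = I_k(π)` and `λ*_1 + ⋯ + λ*_k = D_k(π)` for all `k`. -/
def HasShape {n : ℕ} (π : Equiv.Perm (Fin n)) (lam : YPartition) : Prop :=
  ∀ k : ℕ, psum lam.parts k = incMax π k ∧ psum (conjParts lam) k = decMax π k

theorem size_eq_psum (p : YPartition) {N : ℕ} (hN : ∀ i, N ≤ i → p.parts i = 0) :
    size p = psum p.parts N := by
  have hle (r : ℕ) : psum p.parts r ≤ psum p.parts N := by
    rcases le_total r N with h | h
    · exact Finset.sum_le_sum_of_subset (Finset.range_mono h)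
    · refine (Finset.sum_subset (Finset.range_mono h) fun i _ hi => hN i ?_).ge
      simpa using hi
  have hgreatest : IsGreatest (Set.range (psum p.parts)) (psum p.parts N) := by
    refine ⟨⟨N, rfl⟩, ?_⟩
    rintro _ ⟨r, rfl⟩
    exact hle r
  exact hgreatest.csSup_eq

theorem conjParts_eq_sum_ite (p : YPartition) {N : ℕ} (hN : ∀ i, N ≤ i → p.parts i = 0) (c : ℕ) :
    conjParts p c = ∑ i ∈ Finset.range N, if c + 1 ≤ p.parts i then 1 else 0 := by
  have hset : {j : ℕ | c + 1 ≤ p.parts j} =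
      ((Finset.range N).filter fun j => c + 1 ≤ p.parts j : Finset ℕ) := by
    ext j
    simp only [Set.mem_ofPred_eq, Finset.coe_filter, Finset.mem_range]
    refine ⟨fun h => ⟨?_, h⟩, fun h => h.2⟩
    by_contra hj
    have := hN j (not_lt.mp hj)
    omega
  rw [conjParts, hset, Set.ncard_coe_finset, Finset.card_filter]

/-- The first `c` columns of a Young diagram contain `min (p i) c` cells of row `i`. -/
theorem psum_conjParts (p : YPartition) {N : ℕ} (hN : ∀ i, N ≤ i → p.parts i = 0) (c : ℕ) :
    psum (conjParts p) c = ∑ i ∈ Finset.range N, min (p.parts i) c := by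
  induction c with
  | zero => simp [psum]
  | succ c ih =>
    have hstep : psum (conjParts p) (c + 1) = psum (conjParts p) c + conjParts p c :=
      Finset.sum_range_succ _ _
    rw [hstep, ih, conjParts_eq_sum_ite p hN, ← Finset.sum_add_distrib]
    refine Finset.sum_congr rfl fun i _ => ?_
    split_ifs <;> omega

/-- Cutting `p` at column `c` leaves at most `c` cells in each of the first `r` rows. -/
theorem sum_min_le_mul_add_tail (f : ℕ → ℕ) (r M c : ℕ) :
    ∑ i ∈ Finset.range (r + M), min (f i) c ≤ r * c + ∑ i ∈ Finset.range M, f (r + i) := by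
  rw [Finset.sum_range_add]
  refine Nat.add_le_add ?_ (Finset.sum_le_sum fun i _ => min_le_left _ _)
  simpa using Finset.sum_le_card_nsmul (Finset.range r) (fun i => min (f i) c) c
    fun i _ => min_le_right _ _

theorem sum_min_eq_mul_add_tail (p : YPartition) (r M : ℕ) :
    ∑ i ∈ Finset.range (r + M), min (p.parts i) (p.parts r) =
      r * p.parts r + ∑ i ∈ Finset.range M, p.parts (r + i) := by
  rw [Finset.sum_range_add]
  congr 1
  · rw [Finset.sum_congr rfl fun i hi =>
      min_eq_right (p.antitone i r (Finset.mem_range.mp hi).le)]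
    simp
  · exact Finset.sum_congr rfl fun i _ => min_eq_left (p.antitone r (r + i) (Nat.le_add_right r i))

theorem row_sum_gap_le_one (lam μ : YPartition)
    (hdom : DoublyDominates μ lam) (hsize : size μ = size lam + 1) :
    ∀ r : ℕ, 1 ≤ r →
      psum lam.parts r ≤ psum μ.parts r ∧ psum μ.parts r ≤ psum lam.parts r + 1 := by
  intro r _
  refine ⟨hdom.1 r, ?_⟩
  obtain ⟨A, hA⟩ := lam.finite
  obtain ⟨B, hB⟩ := μ.finite
  have hlam : ∀ i, r + (A + B) ≤ i → lam.parts i = 0 := fun i hi => hA i (by omega)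
  have hμ : ∀ i, r + (A + B) ≤ i → μ.parts i = 0 := fun i hi => hB i (by omega)
  have hcol := hdom.2 (lam.parts r)
  rw [psum_conjParts lam hlam, psum_conjParts μ hμ, sum_min_eq_mul_add_tail] at hcol
  have htail := hcol.trans (sum_min_le_mul_add_tail μ.parts r (A + B) (lam.parts r))
  rw [size_eq_psum lam hlam, size_eq_psum μ hμ] at hsize
  simp only [psum, Finset.sum_range_add _ r] at hsize ⊢
  omega
end

section
/- A permutation class C is a Young class if and only if there is a set D of partitions that is downwards closed in the double domination order such that C = {π : sh(π) ∈ D}. -/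
/-- A permutation of arbitrary (finite) length. -/
abbrev SPerm : Type := (n : ℕ) × Equiv.Perm (Fin n)

/-- Involvement for permutations of arbitrary lengths. -/
def InvolvedS (σ π : SPerm) : Prop := Involved σ.2 π.2

/-- `π` has RSK shape `lam`. -/
def HasShapeS (π : SPerm) (lam : YPartition) : Prop := HasShape π.2 lam

/-- A permutation class: a set of permutations downwards closed under involvement. -/
def IsPermClass (C : Set SPerm) : Prop := ∀ π ∈ C, ∀ σ : SPerm, InvolvedS σ π → σ ∈ C

/-- A Young class: a permutation class which, for each partition, contains either all
permutations of that shape or none of them. -/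
def IsYoungClass (C : Set SPerm) : Prop :=
  IsPermClass C ∧ ∀ lam : YPartition,
    (∀ π : SPerm, HasShapeS π lam → π ∈ C) ∨ (∀ π : SPerm, HasShapeS π lam → π ∉ C)

/-- The maximum size of a set of indices that splits into `k` classes on each of which `R` holds
between any two indices in increasing order. -/
noncomputable def maxUnion {n : ℕ} (R : Fin n → Fin n → Prop) (k : ℕ) : ℕ :=
  sSup {m : ℕ | ∃ S : Finset (Fin n),
    (∃ c : Fin n → Fin k, ∀ i ∈ S, ∀ j ∈ S, i < j → c i = c j → R i j) ∧ S.card = m}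

section MaxUnion

variable {n : ℕ}

theorem incMax_eq_maxUnion (π : Equiv.Perm (Fin n)) :
    incMax π = maxUnion fun i j => π i < π j := rfl

theorem decMax_eq_maxUnion (π : Equiv.Perm (Fin n)) :
    decMax π = maxUnion fun i j => π j < π i := rfl

theorem maxUnion_bddAbove (R : Fin n → Fin n → Prop) (k : ℕ) :
    BddAbove {m : ℕ | ∃ S : Finset (Fin n),
      (∃ c : Fin n → Fin k, ∀ i ∈ S, ∀ j ∈ S, i < j → c i = c j → R i j) ∧ S.card = m} := by
  refine ⟨n, ?_⟩
  rintro m ⟨S, -, rfl⟩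
  simpa using S.card_le_univ

theorem card_le_maxUnion {R : Fin n → Fin n → Prop} {k : ℕ} {γ : Type*} (S : Finset (Fin n))
    (colors : Finset γ) (hk : colors.card ≤ k) (c : Fin n → γ) (hc : ∀ i ∈ S, c i ∈ colors)
    (hR : ∀ i ∈ S, ∀ j ∈ S, i < j → c i = c j → R i j) : S.card ≤ maxUnion R k := by
  classical
  rcases S.eq_empty_or_nonempty with rfl | ⟨i₀, hi₀⟩
  · simp
  have hpos : 0 < colors.card := Finset.card_pos.mpr ⟨_, hc _ hi₀⟩
  have : NeZero k := ⟨by omega⟩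
  refine le_csSup (maxUnion_bddAbove R k) ⟨S, ⟨fun i => if h : c i ∈ colors then
    Fin.castLE hk (colors.equivFin ⟨c i, h⟩) else 0, ?_⟩, rfl⟩
  intro i hi j hj hij h
  simp only [hc i hi, hc j hj, dif_pos] at h
  have h' := colors.equivFin.injective (Fin.castLE_injective hk h)
  exact hR i hi j hj hij (congrArg Subtype.val h')

theorem exists_card_eq_maxUnion (R : Fin n → Fin n → Prop) (k : ℕ) :
    ∃ (S : Finset (Fin n)) (c : Fin n → ℕ), (∀ i ∈ S, c i < k) ∧
      (∀ i ∈ S, ∀ j ∈ S, i < j → c i = c j → R i j) ∧ S.card = maxUnion R k := by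
  by_cases hne : {m : ℕ | ∃ S : Finset (Fin n),
    (∃ c : Fin n → Fin k, ∀ i ∈ S, ∀ j ∈ S, i < j → c i = c j → R i j) ∧ S.card = m}.Nonempty
  · obtain ⟨S, ⟨c, hc⟩, hS⟩ := Nat.sSup_mem hne (maxUnion_bddAbove R k)
    exact ⟨S, fun i => c i, fun i _ => (c i).2,
      fun i hi j hj hij h => hc i hi j hj hij (Fin.ext h), hS⟩
  · refine ⟨∅, fun _ => 0, by simp, by simp, ?_⟩
    rw [Set.not_nonempty_iff_eq_empty] at hne
    simp [maxUnion, hne]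

theorem maxUnion_zero (R : Fin n → Fin n → Prop) : maxUnion R 0 = 0 := by
  obtain ⟨S, c, hc, -, hS⟩ := exists_card_eq_maxUnion R 0
  rw [← hS, Finset.card_eq_zero, Finset.eq_empty_iff_forall_notMem]
  exact fun i hi => Nat.not_lt_zero _ (hc i hi)

theorem maxUnion_mono (R : Fin n → Fin n → Prop) : Monotone (maxUnion R) := by
  intro k l hkl
  obtain ⟨S, c, hc, hR, hS⟩ := exists_card_eq_maxUnion R k
  rw [← hS]
  exact card_le_maxUnion S (Finset.range l) (by simp) c
    (fun i hi => Finset.mem_range.mpr ((hc i hi).trans_le hkl)) hR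

theorem maxUnion_le (R : Fin n → Fin n → Prop) (k : ℕ) : maxUnion R k ≤ n := by
  obtain ⟨S, -, -, -, hS⟩ := exists_card_eq_maxUnion R k
  simpa [hS] using S.card_le_univ

theorem maxUnion_self (R : Fin n → Fin n → Prop) : maxUnion R n = n := by
  refine le_antisymm (maxUnion_le R n) ?_
  have := card_le_maxUnion (R := R) (k := n) (Finset.univ : Finset (Fin n)) Finset.univ
    (by simp) id (by simp) (fun i _ j _ hij h => absurd h hij.ne)
  simpa using this

/-- Weak duality: a class of the first kind meets a class of the second kind at most once. -/
theorem maxUnion_add_le {R R' : Fin n → Fin n → Prop} (hRR' : ∀ i j, R i j → ¬ R' i j)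
    (h k : ℕ) : maxUnion R h + maxUnion R' k ≤ n + h * k := by
  obtain ⟨S, c, hc, hR, hS⟩ := exists_card_eq_maxUnion R h
  obtain ⟨T, d, hd, hR', hT⟩ := exists_card_eq_maxUnion R' k
  rw [← hS, ← hT, ← Finset.card_union_add_card_inter]
  refine Nat.add_le_add (by simpa using (S ∪ T).card_le_univ) ?_
  have := Finset.card_le_card_of_injOn (s := S ∩ T) (t := Finset.range h ×ˢ Finset.range k)
    (fun i => (c i, d i)) ?_ ?_
  · simpa using this
  · intro i hi
    simp only [Finset.coe_inter, Set.mem_inter_iff, Finset.mem_coe] at hi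
    simpa using ⟨hc i hi.1, hd i hi.2⟩
  · intro i hi j hj hij
    simp only [Finset.coe_inter, Set.mem_inter_iff, Finset.mem_coe] at hi hj
    simp only [Prod.mk.injEq] at hij
    rcases lt_trichotomy i j with hlt | heq | hlt
    · exact absurd (hR' i hi.2 j hj.2 hlt hij.2) (hRR' _ _ (hR i hi.1 j hj.1 hlt hij.1))
    · exact heq
    · exact absurd (hR' j hj.2 i hi.2 hlt hij.2.symm) (hRR' _ _ (hR j hj.1 i hi.1 hlt hij.1.symm))

end MaxUnion

/-- Egerváry's theorem: an optimal assignment is certified by integral potentials. -/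
theorem exists_perm_potentials {X : Type*} [Fintype X] (w : X → X → ℤ) :
    ∃ (u v : X → ℤ) (τ : Equiv.Perm X), (∀ x y, u x + v y ≤ w x y) ∧
      ∀ x, u x + v (τ x) = w x (τ x) := by
  classical
  let feasible : ℤ → Prop := fun z => ∃ u v : X → ℤ, (∀ x y, u x + v y ≤ w x y) ∧
    z = ∑ x, (u x + v x)
  obtain ⟨z, ⟨u, v, huv, hz⟩, hmax⟩ := Int.exists_greatest_of_bdd (P := feasible)
    ⟨∑ x, w x x, by
      rintro z ⟨u, v, huv, rfl⟩
      exact Finset.sum_le_sum fun x _ => huv x x⟩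
    ⟨_, fun x => -∑ y, |w x y|, fun _ => 0, fun x y => by
      have := Finset.single_le_sum (f := fun y => |w x y|) (fun y _ => abs_nonneg _)
        (Finset.mem_univ y)
      have := neg_abs_le (w x y)
      simp only at *
      linarith, rfl⟩
  let tight : X → Finset X := fun x => Finset.univ.filter fun y => u x + v y = w x y
  have hall : ∀ A : Finset X, A.card ≤ (A.biUnion tight).card := by
    by_contra! hA
    obtain ⟨A, hA⟩ := hA
    have hf : feasible (∑ x, ((u x + if x ∈ A then 1 else 0) +
        (v x - if x ∈ A.biUnion tight then 1 else 0))) := by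
      refine ⟨_, _, fun x y => ?_, rfl⟩
      have h1 := huv x y
      by_cases hx : x ∈ A
      · by_cases hy : y ∈ A.biUnion tight
        · simp only [hx, hy, if_true]
          linarith
        · have : u x + v y ≠ w x y := fun h =>
            hy (Finset.mem_biUnion.mpr ⟨x, hx, by simp [tight, h]⟩)
          have := lt_of_le_of_ne h1 this
          simp only [hx, hy, if_true, if_false]
          linarith
      · simp only [hx, if_false]
        split_ifs <;> linarith
    have h2 := hmax _ hf
    have h3 : ∑ x, ((u x + if x ∈ A then 1 else 0) +
        (v x - if x ∈ A.biUnion tight then 1 else 0)) =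
        ∑ x, (u x + v x) + ((A.card : ℤ) - ((A.biUnion tight).card : ℤ)) := by
      simp only [Finset.sum_add_distrib, Finset.sum_sub_distrib, Finset.sum_ite_mem,
        Finset.univ_inter, Finset.sum_const, nsmul_eq_mul, mul_one]
      ring
    rw [h3, ← hz] at h2
    have : ((A.biUnion tight).card : ℤ) < A.card := by exact_mod_cast hA
    linarith
  obtain ⟨f, hf, hft⟩ := (Finset.all_card_le_biUnion_card_iff_exists_injective tight).mp hall
  refine ⟨u, v, Equiv.ofBijective f (Finite.injective_iff_bijective.mp hf), huv, fun x => ?_⟩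
  simpa [tight] using hft x

section Duality

variable {n : ℕ}

/-- Follow the links of an injective partial successor function backwards to the root. -/
theorem exists_root {X : Type*} (τ : Equiv.Perm (Fin n ⊕ X)) [Inhabited X] :
    ∃ root : Fin n → X, ∀ i, (∀ s, τ (Sum.inr s) = Sum.inl i → root i = s) ∧
      ∀ j, j < i → τ (Sum.inl j) = Sum.inl i → root i = root j := by
  classical
  let F : ∀ i : Fin n, (∀ j : Fin n, j < i → X) → X := fun i rec =>
    Sum.elim (fun j => if h : j < i then rec j h else default) id (τ.symm (Sum.inl i))
  let root : Fin n → X := (wellFounded_lt (α := Fin n)).fix F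
  have hroot : ∀ i, root i = F i fun j _ => root j := (wellFounded_lt (α := Fin n)).fix_eq F
  refine ⟨root, fun i => ⟨fun s hs => ?_, fun j hj hs => ?_⟩⟩
  · rw [hroot]
    simp [F, ← hs]
  · rw [hroot]
    simp [F, ← hs, hj]

theorem reflTransGen_or_of_root_eq {X : Type*} {τ : Equiv.Perm (Fin n ⊕ X)} {root : Fin n → X}
    {R : Fin n → Fin n → Prop}
    (hroot : ∀ i, (∀ s, τ (Sum.inr s) = Sum.inl i → root i = s) ∧
      ∀ j, j < i → τ (Sum.inl j) = Sum.inl i → root i = root j)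
    (hτ : ∀ i j, τ (Sum.inl i) = Sum.inl j → i ≠ j → i < j ∧ R i j) :
    ∀ (N : ℕ) (i j : Fin n), i.val + j.val < N → τ (Sum.inl i) ≠ Sum.inl i →
      τ (Sum.inl j) ≠ Sum.inl j → root i = root j →
      Relation.ReflTransGen (fun a b => τ (Sum.inl a) = Sum.inl b ∧ a < b ∧ R a b) i j ∨
      Relation.ReflTransGen (fun a b => τ (Sum.inl a) = Sum.inl b ∧ a < b ∧ R a b) j i := by
  set E : Fin n → Fin n → Prop := fun a b => τ (Sum.inl a) = Sum.inl b ∧ a < b ∧ R a b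
  have parent : ∀ i, τ (Sum.inl i) ≠ Sum.inl i → (∃ s, τ (Sum.inr s) = Sum.inl i) ∨
      ∃ p, E p i ∧ τ (Sum.inl p) ≠ Sum.inl p := by
    intro i hi
    rcases h : τ.symm (Sum.inl i) with p | s
    · have hp : τ (Sum.inl p) = Sum.inl i := by rw [← h]; simp
      have hpi : p ≠ i := fun e => hi (by rwa [e] at hp)
      refine Or.inr ⟨p, ⟨hp, hτ p i hp hpi⟩, fun e => hpi ?_⟩
      exact Sum.inl_injective (e.symm.trans hp)
    · exact Or.inl ⟨s, by rw [← h]; simp⟩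
  have half : ∀ (i j p q : Fin n), E p i → E q j → Relation.ReflTransGen E p q →
      Relation.ReflTransGen E i j := by
    intro i j p q hpi hqj hpq
    rcases hpq.cases_head with rfl | ⟨y, hy, hyq⟩
    · rw [Sum.inl_injective (hpi.1.symm.trans hqj.1)]
    · rw [Sum.inl_injective (hpi.1.symm.trans hy.1)]
      exact hyq.tail hqj
  have no_pred : ∀ (i p : Fin n) (s : X), τ (Sum.inr s) = Sum.inl i → ¬ E p i :=
    fun i p s hs hp => Sum.inl_ne_inr (τ.injective (hp.1.trans hs.symm))
  have rooted : ∀ (i j q : Fin n) (s : X), τ (Sum.inr s) = Sum.inl i → E q j →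
      (Relation.ReflTransGen E i q ∨ Relation.ReflTransGen E q i) →
      Relation.ReflTransGen E i j := by
    intro i j q s hs hqj h
    rcases h with h | h
    · exact h.tail hqj
    · rcases h.cases_tail with rfl | ⟨y, -, hy⟩
      · exact Relation.ReflTransGen.single hqj
      · exact absurd hy (no_pred _ _ s hs)
  intro N
  induction N with
  | zero => intro i j h; omega
  | succ N ih =>
    intro i j hN hi hj hij
    rcases parent i hi with ⟨s, hs⟩ | ⟨p, hp, hp'⟩ <;>
      rcases parent j hj with ⟨t, ht⟩ | ⟨q, hq, hq'⟩
    · have : s = t := by rw [← (hroot i).1 s hs, ← (hroot j).1 t ht, hij]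
      rw [this, ht] at hs
      rw [Sum.inl_injective hs]
      exact Or.inl .refl
    · have h := hq.2.1
      exact Or.inl (rooted i j q s hs hq
        (ih i q (by omega) hi hq' (hij.trans ((hroot j).2 q h hq.1))))
    · have h := hp.2.1
      exact Or.inr (rooted j i p t ht hp
        (ih j p (by omega) hj hp' (hij.symm.trans ((hroot i).2 p h hp.1))))
    · have h1 := hp.2.1
      have h2 := hq.2.1
      rcases ih p q (by omega) hp' hq' (by
        rw [← (hroot i).2 p h1 hp.1, ← (hroot j).2 q h2 hq.1, hij]) with h | h
      · exact Or.inl (half i j p q hp hq h)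
      · exact Or.inr (half j i q p hq hp h)

theorem exists_add_le_maxUnion {R R' : Fin n → Fin n → Prop}
    (htrans : ∀ i j l, i < j → j < l → R i j → R j l → R i l)
    (htotal : ∀ i j, i < j → ¬ R i j → R' i j) (k : ℕ) :
    ∃ h, n + h * k ≤ maxUnion R h + maxUnion R' k := by
  classical
  let w : Fin n ⊕ Fin (n + 1) → Fin n ⊕ Fin (n + 1) → ℤ := fun x y =>
    match x, y with
    | Sum.inl i, Sum.inl j => if i = j then 1 else if i < j ∧ R i j then 0 else n + 1
    | Sum.inl _, Sum.inr _ => 0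
    | Sum.inr _, Sum.inl _ => k
    | Sum.inr _, Sum.inr _ => 0
  have hw0 : ∀ x y, 0 ≤ w x y := by
    rintro (i | s) (j | t) <;> simp only [w] <;> positivity
  obtain ⟨u, v, τ, huv, hτ⟩ := exists_perm_potentials w
  set T : ℤ := ∑ x, w x (τ x) with hT
  have hTuv : T = ∑ x, (u x + v x) := by
    rw [hT, Finset.sum_add_distrib, ← Equiv.sum_comp τ v, ← Finset.sum_add_distrib]
    exact Finset.sum_congr rfl fun x _ => (hτ x).symm
  have hT0 : 0 ≤ T := Finset.sum_nonneg fun x _ => hw0 _ _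
  have hTn : T ≤ n := by
    rw [hTuv]
    calc ∑ x, (u x + v x) ≤ ∑ x, w x x := Finset.sum_le_sum fun x _ => huv x x
      _ = n := by simp [w, Fintype.sum_sum_type]
  have hlink : ∀ i j, τ (Sum.inl i) = Sum.inl j → i ≠ j → i < j ∧ R i j := by
    intro i j hij hne
    by_contra hcon
    have h1 : w (Sum.inl i) (τ (Sum.inl i)) ≤ T :=
      Finset.single_le_sum (f := fun x => w x (τ x)) (fun x _ => hw0 _ _) (Finset.mem_univ _)
    rw [hij] at h1
    simp only [w, if_neg hne, if_neg hcon] at h1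
    omega
  -- the dual solution gives a union of `k` classes for `R'`
  let F : Finset (Fin n) := Finset.univ.filter fun i => 1 ≤ u (Sum.inl i) + v (Sum.inl i)
  obtain ⟨s, -, hs⟩ := Finset.exists_max_image (Finset.univ : Finset (Fin (n + 1)))
    (fun s => u (Sum.inr s)) Finset.univ_nonempty
  obtain ⟨t, -, ht⟩ := Finset.exists_max_image (Finset.univ : Finset (Fin (n + 1)))
    (fun s => v (Sum.inr s)) Finset.univ_nonempty
  have hst : u (Sum.inr s) + v (Sum.inr t) ≤ 0 := huv _ _
  have hTF : T ≤ F.card + (n + 1) * (u (Sum.inr s) + v (Sum.inr t)) := by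
    rw [hTuv, Fintype.sum_sum_type]
    refine add_le_add ?_ ?_
    · rw [Finset.card_filter, Nat.cast_sum]
      refine Finset.sum_le_sum fun i _ => ?_
      have := huv (Sum.inl i) (Sum.inl i)
      simp only [w, if_true] at this
      split_ifs <;> push_cast <;> omega
    · calc ∑ a, (u (Sum.inr a) + v (Sum.inr a))
          ≤ ∑ _a : Fin (n + 1), (u (Sum.inr s) + v (Sum.inr t)) :=
            Finset.sum_le_sum fun a _ => add_le_add (hs a (Finset.mem_univ _))
              (ht a (Finset.mem_univ _))
        _ = _ := by simp
  have hFn : (F.card : ℤ) ≤ n := by exact_mod_cast (by simpa using F.card_le_univ)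
  have hst0 : u (Sum.inr s) + v (Sum.inr t) = 0 := by nlinarith
  have hF : F.card ≤ maxUnion R' k := by
    refine card_le_maxUnion F (Finset.Ico (v (Sum.inr t) + 1) (v (Sum.inr t) + 1 + k)) (by simp)
      (fun i => v (Sum.inl i)) ?_ ?_
    · intro i hi
      have h1 : 1 ≤ u (Sum.inl i) + v (Sum.inl i) := by simpa [F] using hi
      have h2 : u (Sum.inl i) + v (Sum.inr t) ≤ 0 := huv _ _
      have h3 : u (Sum.inr s) + v (Sum.inl i) ≤ k := huv _ _
      rw [Finset.mem_Ico]
      omega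
    · intro i hi j hj hij hv
      refine htotal i j hij fun hR => ?_
      have h1 : 1 ≤ u (Sum.inl i) + v (Sum.inl i) := by simpa [F] using hi
      have h2 := huv (Sum.inl i) (Sum.inl j)
      simp only [w, if_neg hij.ne, if_pos (And.intro hij hR)] at h2
      omega
  -- the optimal assignment gives a union of `h` classes for `R`
  let H : Finset (Fin (n + 1)) := Finset.univ.filter fun a => ∃ i, τ (Sum.inr a) = Sum.inl i
  let S : Finset (Fin n) := Finset.univ.filter fun i => τ (Sum.inl i) ≠ Sum.inl i
  obtain ⟨root, hroot⟩ := exists_root τ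
  have hS : S.card ≤ maxUnion R H.card := by
    refine card_le_maxUnion S H le_rfl root ?_ ?_
    · suffices ∀ i, τ (Sum.inl i) ≠ Sum.inl i → root i ∈ H from
        fun i hi => this i (by simpa [S] using hi)
      intro i
      induction i using WellFoundedLT.induction with
      | ind i ih =>
        intro hi
        rcases h : τ.symm (Sum.inl i) with p | a
        · have hp : τ (Sum.inl p) = Sum.inl i := by rw [← h]; simp
          have hpi : p ≠ i := fun e => hi (by rwa [e] at hp)
          rw [(hroot i).2 p (hlink p i hp hpi).1 hp]
          exact ih p (hlink p i hp hpi).1 fun e => hpi (Sum.inl_injective (e.symm.trans hp))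
        · have ha : τ (Sum.inr a) = Sum.inl i := by rw [← h]; simp
          rw [(hroot i).1 a ha]
          simp [H, ha]
    · intro i hi j hj hij hr
      have reach : ∀ a b, Relation.ReflTransGen
          (fun a b => τ (Sum.inl a) = Sum.inl b ∧ a < b ∧ R a b) a b →
          a = b ∨ (a < b ∧ R a b) := by
        intro a b hab
        induction hab with
        | refl => exact Or.inl rfl
        | tail _ hbc ih =>
          rcases ih with rfl | ⟨h1, h2⟩
          · exact Or.inr hbc.2
          · exact Or.inr ⟨h1.trans hbc.2.1, htrans _ _ _ h1 hbc.2.1 h2 hbc.2.2⟩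
      rcases reflTransGen_or_of_root_eq hroot hlink _ i j (Nat.lt_succ_self _)
        (by simpa [S] using hi) (by simpa [S] using hj) hr with h | h
      · rcases reach _ _ h with rfl | h
        · exact absurd hij (lt_irrefl _)
        · exact h.2
      · rcases reach _ _ h with rfl | h
        · exact absurd hij (lt_irrefl _)
        · exact absurd h.1 hij.asymm
  have hTSH : (n : ℤ) + H.card * k ≤ T + S.card := by
    rw [hT, Fintype.sum_sum_type]
    have h1 : (n : ℤ) ≤ ∑ i, w (Sum.inl i) (τ (Sum.inl i)) + S.card := by
      rw [Finset.card_filter, Nat.cast_sum, ← Finset.sum_add_distrib]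
      calc (n : ℤ) = ∑ _i : Fin n, 1 := by simp
        _ ≤ _ := Finset.sum_le_sum fun i _ => by
          have := hw0 (Sum.inl i) (τ (Sum.inl i))
          by_cases h : τ (Sum.inl i) = Sum.inl i
          · simp [h, w]
          · simp only [ne_eq, h, not_false_eq_true, if_true]
            push_cast
            omega
    have h2 : (H.card : ℤ) * k ≤ ∑ a, w (Sum.inr a) (τ (Sum.inr a)) := by
      rw [Finset.card_filter, Nat.cast_sum, Finset.sum_mul]
      refine Finset.sum_le_sum fun a _ => ?_
      split_ifs with h
      · obtain ⟨i, hi⟩ := h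
        simp [hi, w]
      · simpa using hw0 _ _
    linarith
  refine ⟨H.card, ?_⟩
  have h1 : T ≤ F.card := by rw [hst0] at hTF; simpa using hTF
  zify
  zify at hF hS
  linarith

end Duality

/-- The functions `a` and `b` are the row lengths and column lengths of one Young diagram. -/
def ConjugatePair (a b : ℕ → ℕ) : Prop := ∀ r c, c < a r ↔ r < b c

/-- The cells of the Young diagram with row lengths `a` and column lengths `b`. -/
def cells (a b : ℕ → ℕ) : Finset (ℕ × ℕ) :=
  (Finset.range (b 0) ×ˢ Finset.range (a 0)).filter fun p => p.2 < a p.1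

section Diagram

variable {a b : ℕ → ℕ}

theorem ConjugatePair.symm (h : ConjugatePair a b) : ConjugatePair b a := fun r c => (h c r).symm

theorem ConjugatePair.antitone (h : ConjugatePair a b) : Antitone a := by
  intro r s hrs
  by_contra! hlt
  exact lt_irrefl _ ((h r (a r)).mpr (hrs.trans_lt ((h s (a r)).mp hlt)))

theorem mem_cells (h : ConjugatePair a b) {p : ℕ × ℕ} : p ∈ cells a b ↔ p.2 < a p.1 := by
  simp only [cells, Finset.mem_filter, Finset.mem_product, Finset.mem_range,
    and_iff_right_iff_imp]
  intro hp
  exact ⟨(h _ _).mp ((Nat.zero_le _).trans_lt hp), hp.trans_le (h.antitone (Nat.zero_le _))⟩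

theorem psum_zero (f : ℕ → ℕ) : psum f 0 = 0 := rfl

theorem psum_succ (f : ℕ → ℕ) (r : ℕ) : psum f (r + 1) = psum f r + f r :=
  Finset.sum_range_succ f r

theorem card_cells_row (h : ConjugatePair a b) (r : ℕ) :
    ((cells a b).filter fun p => p.1 = r).card = a r := by
  rw [← Finset.card_range (a r)]
  refine Finset.card_nbij' (fun p => p.2) (fun c => (r, c)) ?_ ?_ ?_ ?_
  · rintro ⟨x, y⟩ hp
    simp only [Finset.coe_filter, Set.mem_ofPred_eq, mem_cells h] at hp
    simpa [← hp.2] using hp.1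
  · intro c hc
    simpa [mem_cells h] using hc
  · rintro ⟨x, y⟩ hp
    simp only [Finset.coe_filter, Set.mem_ofPred_eq] at hp
    simp [hp.2]
  · exact fun c _ => rfl

theorem card_cells_rows (h : ConjugatePair a b) (r : ℕ) :
    ((cells a b).filter fun p => p.1 < r).card = psum a r := by
  induction r with
  | zero => simp [psum_zero]
  | succ r ih =>
    rw [psum_succ, ← ih, ← card_cells_row h r, ← Finset.card_union_of_disjoint]
    · congr 1
      ext p
      simp only [Finset.mem_filter, Finset.mem_union]
      grind
    · rw [Finset.disjoint_filter]
      intro p _ h1 h2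
      omega

theorem card_cells_comm (h : ConjugatePair a b) : (cells a b).card = (cells b a).card := by
  refine Finset.card_nbij' Prod.swap Prod.swap ?_ ?_ (by simp [Set.LeftInvOn])
    (by simp [Set.LeftInvOn])
  · rintro ⟨x, y⟩ hp
    simpa [mem_cells h, mem_cells h.symm, h x y] using hp
  · rintro ⟨x, y⟩ hp
    simpa [mem_cells h, mem_cells h.symm, h y x] using hp

theorem card_cells_columns (h : ConjugatePair a b) (m : ℕ) :
    ((cells a b).filter fun p => p.2 < m).card = psum b m := by
  rw [← card_cells_rows h.symm]
  refine Finset.card_nbij' Prod.swap Prod.swap ?_ ?_ (by simp [Set.LeftInvOn])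
    (by simp [Set.LeftInvOn])
  · rintro ⟨x, y⟩ hp
    simpa [mem_cells h, mem_cells h.symm, h x y] using hp
  · rintro ⟨x, y⟩ hp
    simpa [mem_cells h, mem_cells h.symm, h y x] using hp

theorem psum_le_card_cells (h : ConjugatePair a b) (r : ℕ) : psum a r ≤ (cells a b).card := by
  rw [← card_cells_rows h]
  exact Finset.card_filter_le _ _

theorem psum_eq_card_cells (h : ConjugatePair a b) {r : ℕ} (hr : b 0 ≤ r) :
    psum a r = (cells a b).card := by
  rw [← card_cells_rows h, Finset.filter_true_of_mem]
  intro p hp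
  exact ((h _ _).mp ((Nat.zero_le _).trans_lt ((mem_cells h).mp hp))).trans_le hr

theorem psum_add_psum_le (h : ConjugatePair a b) (r m : ℕ) :
    psum a r + psum b m ≤ (cells a b).card + r * m := by
  rw [← card_cells_rows h, ← card_cells_columns h, ← Finset.card_union_add_card_inter]
  refine Nat.add_le_add (Finset.card_le_card ?_) ?_
  · exact Finset.union_subset (Finset.filter_subset _ _) (Finset.filter_subset _ _)
  · calc _ ≤ (Finset.range r ×ˢ Finset.range m).card := Finset.card_le_card fun p hp => by
          simp only [Finset.mem_inter, Finset.mem_filter] at hp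
          simpa using ⟨hp.1.2, hp.2.2⟩
      _ = r * m := by simp

theorem psum_add_psum_eq (h : ConjugatePair a b) {r m : ℕ} (h1 : ∀ i < r, m ≤ a i)
    (h2 : ∀ i, r ≤ i → a i ≤ m) : psum a r + psum b m = (cells a b).card + r * m := by
  refine le_antisymm (psum_add_psum_le h r m) ?_
  rw [← card_cells_rows h, ← card_cells_columns h, ← Finset.card_union_add_card_inter]
  refine Nat.add_le_add (Finset.card_le_card ?_) ?_
  · intro p hp
    have := (mem_cells h).mp hp
    simp only [Finset.mem_union, Finset.mem_filter, hp, true_and]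
    by_contra! hcon
    have := h2 _ hcon.1
    omega
  · calc r * m = (Finset.range r ×ˢ Finset.range m).card := by simp
      _ ≤ _ := Finset.card_le_card fun p hp => by
          simp only [Finset.mem_product, Finset.mem_range] at hp
          have := h1 _ hp.1
          simp only [Finset.mem_inter, Finset.mem_filter, mem_cells h]
          omega

theorem psum_add_psum_row (h : ConjugatePair a b) (r : ℕ) :
    psum a r + psum b (a r) = (cells a b).card + r * a r :=
  psum_add_psum_eq h (fun _ hi => h.antitone hi.le) fun _ hi => h.antitone hi

theorem psum_add_psum_column (h : ConjugatePair a b) (m : ℕ) :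
    psum a (b m) + psum b m = (cells a b).card + b m * m := by
  have := psum_add_psum_row h.symm m
  rw [card_cells_comm h.symm] at this
  linarith

theorem eq_of_psum_eq {f g : ℕ → ℕ} (h : ∀ r, psum f r = psum g r) : f = g := by
  funext r
  have h1 := h (r + 1)
  rw [psum_succ, psum_succ, h r] at h1
  omega

theorem conjugatePair_conjParts (p : YPartition) : ConjugatePair p.parts (conjParts p) := by
  intro r c
  have hset : {j : ℕ | c + 1 ≤ p.parts j} = Set.Iio (sInf {j | p.parts j ≤ c}) := by
    ext j
    obtain ⟨N, hN⟩ := p.finite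
    have hne : {j | p.parts j ≤ c}.Nonempty := ⟨N, by simp [hN N le_rfl]⟩
    simp only [Set.mem_ofPred_eq, Set.mem_Iio]
    constructor
    · intro hj
      by_contra! hcon
      have h1 : p.parts _ ≤ c := Nat.sInf_mem hne
      have := p.antitone _ _ hcon
      omega
    · intro hj
      have := Nat.notMem_of_lt_sInf hj
      simp only [Set.mem_ofPred_eq] at this
      omega
  have hmem : r ∈ {j : ℕ | c + 1 ≤ p.parts j} ↔ r < conjParts p c := by
    rw [conjParts, hset]
    simp
  exact hmem

theorem YPartition.ext_parts {p q : YPartition} (h : p.parts = q.parts) : p = q := by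
  cases p
  cases q
  simpa using h

/-- A partition with prescribed partial sums. -/
theorem exists_partition_psum {I : ℕ → ℕ} {N : ℕ} (h0 : I 0 = 0) (hmono : Monotone I)
    (hconc : ∀ r, I r + I (r + 2) ≤ 2 * I (r + 1)) (hbdd : ∀ r, I r ≤ N) :
    ∃ p : YPartition, ∀ r, psum p.parts r = I r := by
  have hanti : Antitone fun r => I (r + 1) - I r := antitone_nat_of_succ_le fun r => by
    have h1 := hconc r
    have h2 := hmono (Nat.le_succ r)
    simp only [Nat.succ_eq_add_one] at h2
    show I (r + 1 + 1) - I (r + 1) ≤ I (r + 1) - I r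
    have : r + 2 = r + 1 + 1 := rfl
    rw [this] at h1
    omega
  have hsum : ∀ r, psum (fun r => I (r + 1) - I r) r = I r := by
    intro r
    induction r with
    | zero => simp [psum_zero, h0]
    | succ r ih =>
      have := hmono (Nat.le_succ r)
      simp only [Nat.succ_eq_add_one] at this
      rw [psum_succ, ih]
      omega
  refine ⟨⟨fun r => I (r + 1) - I r, fun i j hij => hanti hij, N, fun i hi => ?_⟩, hsum⟩
  by_contra hne
  have h1 : ∀ r, r ≤ i + 1 → r ≤ I r := by
    intro r
    induction r with
    | zero => simp
    | succ r ih =>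
      intro hr
      have h2 := ih (by omega)
      have h3 := hanti (show r ≤ i by omega)
      simp only at h3
      omega
  have := h1 (i + 1) le_rfl
  have := hbdd (i + 1)
  omega

end Diagram

section Greene

variable {n : ℕ}

theorem incMax_add_decMax_le (π : Equiv.Perm (Fin n)) (h k : ℕ) :
    incMax π h + decMax π k ≤ n + h * k :=
  maxUnion_add_le (fun _ _ h1 h2 => h1.asymm h2) h k

theorem exists_add_le_incMax_add_decMax_left (π : Equiv.Perm (Fin n)) (k : ℕ) :
    ∃ h, n + h * k ≤ incMax π h + decMax π k :=
  exists_add_le_maxUnion (fun _ _ _ _ _ h1 h2 => h1.trans h2)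
    (fun _ _ hij h => lt_of_le_of_ne (not_lt.mp h) fun e => hij.ne (π.injective e.symm)) k

theorem exists_add_le_incMax_add_decMax_right (π : Equiv.Perm (Fin n)) (h : ℕ) :
    ∃ k, n + h * k ≤ incMax π h + decMax π k := by
  obtain ⟨k, hk⟩ := exists_add_le_maxUnion (R := fun i j => π j < π i) (R' := fun i j => π i < π j)
    (fun _ _ _ _ _ h1 h2 => h2.trans h1)
    (fun _ _ hij h => lt_of_le_of_ne (not_lt.mp h) fun e => hij.ne (π.injective e)) h
  refine ⟨k, ?_⟩
  rw [incMax_eq_maxUnion, decMax_eq_maxUnion]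
  linarith

/-- Greene's theorem: every permutation has a shape. -/
theorem exists_hasShape (π : Equiv.Perm (Fin n)) : ∃ p : YPartition, HasShape π p := by
  obtain ⟨p, hp⟩ := exists_partition_psum (I := incMax π) (N := n) (maxUnion_zero _)
    (maxUnion_mono _) (fun r => by
      obtain ⟨k, hk⟩ := exists_add_le_incMax_add_decMax_right π (r + 1)
      have h1 := incMax_add_decMax_le π r k
      have h2 := incMax_add_decMax_le π (r + 2) k
      linarith) (maxUnion_le _)
  refine ⟨p, fun k => ⟨hp k, ?_⟩⟩
  have hconj := conjugatePair_conjParts p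
  have hcard : (cells p.parts (conjParts p)).card = n := by
    refine le_antisymm ?_ ?_
    · rw [← psum_eq_card_cells hconj le_rfl, hp]
      exact maxUnion_le _ _
    · have := psum_le_card_cells hconj n
      rwa [hp, incMax_eq_maxUnion, maxUnion_self] at this
  refine le_antisymm ?_ ?_
  · obtain ⟨h, hh⟩ := exists_add_le_incMax_add_decMax_left π k
    have := psum_add_psum_le hconj h k
    rw [hp, hcard] at this
    linarith
  · have h1 := psum_add_psum_column hconj k
    rw [hp, hcard] at h1
    have h2 := incMax_add_decMax_le π (conjParts p k) k
    linarith

theorem HasShape.unique {π : Equiv.Perm (Fin n)} {p q : YPartition} (hp : HasShape π p)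
    (hq : HasShape π q) : p = q :=
  YPartition.ext_parts (eq_of_psum_eq fun r => (hp r).1.trans (hq r).1.symm)

/-- By weak duality, lower bounds suffice to determine the shape. -/
theorem hasShape_of_le {π : Equiv.Perm (Fin n)} {p : YPartition}
    (hn : (cells p.parts (conjParts p)).card = n)
    (hI : ∀ k, psum p.parts k ≤ incMax π k) (hD : ∀ k, psum (conjParts p) k ≤ decMax π k) :
    HasShape π p := by
  have hconj := conjugatePair_conjParts p
  refine fun k => ⟨(hI k).antisymm ?_, (hD k).antisymm ?_⟩
  · have h1 := psum_add_psum_row hconj k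
    have h2 := incMax_add_decMax_le π k (p.parts k)
    have h3 := hD (p.parts k)
    rw [hn] at h1
    linarith
  · have h1 := psum_add_psum_column hconj k
    have h2 := incMax_add_decMax_le π (conjParts p k) k
    have h3 := hI (conjParts p k)
    rw [hn] at h1
    linarith

theorem maxUnion_le_of_strictMono {m : ℕ} {R : Fin m → Fin m → Prop} {R' : Fin n → Fin n → Prop}
    {f : Fin m → Fin n} (hf : StrictMono f) (hR : ∀ i j, R i j → R' (f i) (f j)) (k : ℕ) :
    maxUnion R k ≤ maxUnion R' k := by
  obtain ⟨S, c, hc, hS, hcard⟩ := exists_card_eq_maxUnion R k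
  rw [← hcard, ← Finset.card_map ⟨f, hf.injective⟩]
  refine card_le_maxUnion _ (Finset.range k) (by simp) (Function.extend f c 0) ?_ ?_
  · intro i hi
    obtain ⟨x, hx, rfl⟩ := Finset.mem_map.mp hi
    simpa [hf.injective.extend_apply] using hc x hx
  · intro i hi j hj hij h
    obtain ⟨x, hx, rfl⟩ := Finset.mem_map.mp hi
    obtain ⟨y, hy, rfl⟩ := Finset.mem_map.mp hj
    simp only [Function.Embedding.coeFn_mk, hf.injective.extend_apply] at h hij ⊢
    exact hR _ _ (hS x hx y hy (hf.lt_iff_lt.mp hij) h)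

theorem Involved.doublyDominates {m : ℕ} {σ : Equiv.Perm (Fin m)} {π : Equiv.Perm (Fin n)}
    {p q : YPartition} (h : Involved σ π) (hσ : HasShape σ p) (hπ : HasShape π q) :
    DoublyDominates q p := by
  obtain ⟨f, hf, hfσ⟩ := h
  refine ⟨fun r => ?_, fun r => ?_⟩
  · rw [(hσ r).1, (hπ r).1]
    exact maxUnion_le_of_strictMono hf (fun i j => (hfσ i j).mp) r
  · rw [(hσ r).2, (hπ r).2]
    exact maxUnion_le_of_strictMono hf (fun i j => (hfσ j i).mp) r

end Greene

section Domination

variable {a b a' b' : ℕ → ℕ}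

/-- Domination of the column lengths is a one-sided Lipschitz bound on the row sums. -/
theorem psum_add_card_le (h : ConjugatePair a b) (h' : ConjugatePair a' b')
    (hd : ∀ r, psum b' r ≤ psum b r) (r : ℕ) :
    psum a r + (cells a' b').card ≤ psum a' r + (cells a b).card := by
  have h1 := psum_add_psum_le h r (a' r)
  have h2 := psum_add_psum_row h' r
  have h3 := hd (a' r)
  linarith

theorem psum_conj_le (h : ConjugatePair a b) (h' : ConjugatePair a' b')
    (hd : ∀ r, psum a r + (cells a' b').card ≤ psum a' r + (cells a b).card) (m : ℕ) :
    psum b' m ≤ psum b m := by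
  have h1 := psum_add_psum_column h m
  have h2 := psum_add_psum_le h' (b m) m
  have h3 := hd (b m)
  linarith

theorem DoublyDominates.card_le {μ lam : YPartition} (h : DoublyDominates μ lam) :
    (cells lam.parts (conjParts lam)).card ≤ (cells μ.parts (conjParts μ)).card := by
  have h1 := psum_add_card_le (conjugatePair_conjParts μ) (conjugatePair_conjParts lam) h.2 0
  simpa [psum_zero] using h1

/-- Interpolation: between two comparable partitions there is one that is larger by a single
cell than the smaller one. -/
theorem DoublyDominates.exists_between {μ lam : YPartition} (h : DoublyDominates μ lam)
    (hlt : (cells lam.parts (conjParts lam)).card < (cells μ.parts (conjParts μ)).card) :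
    ∃ ν : YPartition, DoublyDominates μ ν ∧ DoublyDominates ν lam ∧
      (cells ν.parts (conjParts ν)).card = (cells lam.parts (conjParts lam)).card + 1 := by
  have hμ := conjugatePair_conjParts μ
  have hl := conjugatePair_conjParts lam
  have hle := psum_add_card_le hμ hl h.2
  set L := (cells lam.parts (conjParts lam)).card with hL
  set M := (cells μ.parts (conjParts μ)).card with hM
  have hstep : ∀ (p : YPartition) (r : ℕ), psum p.parts (r + 1) = psum p.parts r + p.parts r ∧
      psum p.parts (r + 2) = psum p.parts (r + 1) + p.parts (r + 1) ∧
      p.parts (r + 1) ≤ p.parts r := fun p r =>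
    ⟨psum_succ _ _, psum_succ _ _, p.antitone _ _ (Nat.le_succ r)⟩
  obtain ⟨ν, hν⟩ := exists_partition_psum
    (I := fun r => min (psum μ.parts r) (psum lam.parts r + 1)) (N := M) (by simp [psum_zero])
    (monotone_nat_of_le_succ fun r => by
      have h1 := hstep μ r
      have h2 := hstep lam r
      omega)
    (fun r => by
      have h1 := hstep μ r
      have h2 := hstep lam r
      omega)
    (fun r => (min_le_left _ _).trans (psum_le_card_cells hμ r))
  have hνc := conjugatePair_conjParts ν
  have hcard : (cells ν.parts (conjParts ν)).card = L + 1 := by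
    have h1 := psum_eq_card_cells hνc (le_max_left (conjParts ν 0)
      (max (conjParts μ 0) (conjParts lam 0)))
    have h2 := psum_eq_card_cells hμ ((le_max_left (conjParts μ 0) (conjParts lam 0)).trans
      (le_max_right (conjParts ν 0) _))
    have h3 := psum_eq_card_cells hl ((le_max_right (conjParts μ 0) (conjParts lam 0)).trans
      (le_max_right (conjParts ν 0) _))
    rw [hν, h2, h3] at h1
    omega
  refine ⟨ν, ⟨fun r => ?_, psum_conj_le hμ hνc fun r => ?_⟩,
    ⟨fun r => ?_, psum_conj_le hνc hl fun r => ?_⟩, hcard⟩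
  · rw [hν]
    exact min_le_left _ _
  · have := hle r
    rw [hν, hcard]
    omega
  · have := h.1 r
    rw [hν]
    omega
  · rw [hν, hcard]
    have := min_le_right (psum μ.parts r) (psum lam.parts r + 1)
    omega

theorem DoublyDominates.eq_of_card_eq {μ lam : YPartition} (h : DoublyDominates μ lam)
    (heq : (cells lam.parts (conjParts lam)).card = (cells μ.parts (conjParts μ)).card) :
    μ = lam := by
  refine YPartition.ext_parts (eq_of_psum_eq fun r => le_antisymm ?_ (h.1 r))
  have := psum_add_card_le (conjugatePair_conjParts μ) (conjugatePair_conjParts lam) h.2 r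
  omega

end Domination

/-- Row `r` is longer by one cell in the larger diagram. -/
def PlusRow (a c : ℕ → ℕ) (r : ℕ) : Prop :=
  psum a r = psum c r ∧ psum a (r + 1) ≠ psum c (r + 1)

/-- Row `r` is shorter by one cell in the larger diagram. -/
def MinusRow (a c : ℕ → ℕ) (r : ℕ) : Prop :=
  psum a r ≠ psum c r ∧ psum a (r + 1) = psum c (r + 1)

section Rerouting

variable {a b a' b' : ℕ → ℕ}

open Classical in
theorem count_plusRow_eq (r : ℕ) : Nat.count (PlusRow a a') r =
    Nat.count (MinusRow a a') r + if psum a r = psum a' r then 0 else 1 := by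
  induction r with
  | zero => simp [psum_zero]
  | succ r ih =>
    rw [Nat.count_succ, Nat.count_succ, ih]
    by_cases h1 : psum a r = psum a' r <;> by_cases h2 : psum a (r + 1) = psum a' (r + 1) <;>
      simp [PlusRow, MinusRow, h1, h2]

open Classical in
theorem count_add_count_add_count (r : ℕ) : Nat.count (PlusRow a a') r +
    Nat.count (MinusRow a a') r +
    Nat.count (fun r => ¬ PlusRow a a' r ∧ ¬ MinusRow a a' r) r = r := by
  induction r with
  | zero => simp
  | succ r ih =>
    rw [Nat.count_succ, Nat.count_succ, Nat.count_succ]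
    by_cases h1 : PlusRow a a' r
    · have h2 : ¬ MinusRow a a' r := fun h => h.1 h1.1
      simp only [h1, h2, not_true_eq_false, not_false_eq_true, false_and, if_true, if_false]
      omega
    · by_cases h2 : MinusRow a a' r <;>
        simp only [h1, h2, not_true_eq_false, not_false_eq_true, and_false, and_true, if_true,
          if_false] <;> omega

/-- Whenever row sums agree at a tight row, column sums differ. -/
theorem psum_column_ne (h : ConjugatePair a b) (h' : ConjugatePair a' b')
    (hcard : (cells a b).card = (cells a' b').card + 1) {r m : ℕ}
    (h1 : ∀ i < r, m ≤ a i) (h2 : ∀ i, r ≤ i → a i ≤ m) (hr : psum a r = psum a' r) :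
    psum b m ≠ psum b' m := by
  have h3 := psum_add_psum_eq h h1 h2
  have h4 := psum_add_psum_le h' r m
  omega

theorem psum_column_ne_row (h : ConjugatePair a b) (h' : ConjugatePair a' b')
    (hcard : (cells a b).card = (cells a' b').card + 1) {r : ℕ} (hr : psum a r = psum a' r) :
    psum b (a r) ≠ psum b' (a r) :=
  psum_column_ne h h' hcard (fun _ hi => h.antitone hi.le) (fun _ hi => h.antitone hi) hr

theorem psum_column_ne_between (h : ConjugatePair a b) (h' : ConjugatePair a' b')
    (hcard : (cells a b).card = (cells a' b').card + 1) {r s m : ℕ} (hrs : r < s)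
    (hz : ∀ i, r < i → i ≤ s → psum a i = psum a' i) (h1 : a s ≤ m) (h2 : m ≤ a r) :
    psum b m ≠ psum b' m := by
  have hex : ∃ i, r < i ∧ a i ≤ m := ⟨s, hrs, h1⟩
  have hmin := Nat.find_spec hex
  refine psum_column_ne h h' hcard (r := Nat.find hex) (fun i hi => ?_)
    (fun i hi => (h.antitone hi).trans hmin.2) (hz _ hmin.1 (Nat.find_min' hex ⟨hrs, h1⟩))
  by_cases hir : i ≤ r
  · exact h2.trans (h.antitone hir)
  · have := Nat.find_min hex hi
    simp only [not_and, not_le] at this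
    exact (this (not_le.mp hir)).le

variable {r₁ c₁ : ℕ} {kr kc : ℕ → ℤ}

/-- Two cells are comparable when rows are stacked by `kr` and columns are ordered by `kc`. -/
def ChainComparable (kr kc : ℕ → ℤ) (p q : ℕ × ℕ) : Prop :=
  p.1 = q.1 ∨ (kc p.2 < kc q.2 ∧ kr p.1 < kr q.1) ∨ (kc q.2 < kc p.2 ∧ kr q.1 < kr p.1)

theorem ChainComparable.symm {p q : ℕ × ℕ} (h : ChainComparable kr kc p q) :
    ChainComparable kr kc q p := by
  rcases h with h | h | h
  · exact Or.inl h.symm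
  · exact Or.inr (Or.inr h)
  · exact Or.inr (Or.inl h)

open Classical in
/-- Colors of the chains avoiding the cell `(r₁, c₁)`: the chains above it, the chains below it,
and the unaffected rows. -/
noncomputable def rerouteColor (a a' : ℕ → ℕ) (r₁ c₁ : ℕ) (kc : ℕ → ℤ) (p : ℕ × ℕ) : ℕ × ℕ :=
  if PlusRow a a' p.1 then
    if kc c₁ < kc p.2 then (1, Nat.count (PlusRow a a') (p.1 + 1))
    else if p.1 = r₁ then (0, 0) else (1, Nat.count (PlusRow a a') p.1)
  else if MinusRow a a' p.1 then
    if kc p.2 < kc c₁ then (0, Nat.count (MinusRow a a') (p.1 + 1))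
    else (0, Nat.count (MinusRow a a') p.1)
  else (2, p.1)

open Classical in
theorem rerouteColor_cases (a a' : ℕ → ℕ) (r₁ c₁ : ℕ) (kc : ℕ → ℤ) (p : ℕ × ℕ) :
    (PlusRow a a' p.1 ∧ kc c₁ < kc p.2 ∧
      rerouteColor a a' r₁ c₁ kc p = (1, Nat.count (PlusRow a a') p.1 + 1)) ∨
    (PlusRow a a' p.1 ∧ kc p.2 ≤ kc c₁ ∧ p.1 ≠ r₁ ∧
      rerouteColor a a' r₁ c₁ kc p = (1, Nat.count (PlusRow a a') p.1)) ∨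
    (p.1 = r₁ ∧ kc p.2 ≤ kc c₁ ∧ rerouteColor a a' r₁ c₁ kc p = (0, 0)) ∨
    (MinusRow a a' p.1 ∧ kc p.2 < kc c₁ ∧
      rerouteColor a a' r₁ c₁ kc p = (0, Nat.count (MinusRow a a') p.1 + 1)) ∨
    (MinusRow a a' p.1 ∧ kc c₁ ≤ kc p.2 ∧
      rerouteColor a a' r₁ c₁ kc p = (0, Nat.count (MinusRow a a') p.1)) ∨
    (¬ PlusRow a a' p.1 ∧ ¬ MinusRow a a' p.1 ∧ rerouteColor a a' r₁ c₁ kc p = (2, p.1)) := by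
  by_cases h1 : PlusRow a a' p.1
  · by_cases h2 : kc c₁ < kc p.2
    · simp [rerouteColor, h1, h2, Nat.count_succ]
    · by_cases h3 : p.1 = r₁
      · have h1' := h1
        rw [h3] at h1'
        simp [rerouteColor, h1', h2, h3, not_lt.mp h2]
      · simp [rerouteColor, h1, h2, h3, not_lt.mp h2]
  · by_cases h2 : MinusRow a a' p.1
    · by_cases h3 : kc p.2 < kc c₁
      · simp [rerouteColor, h1, h2, h3, Nat.count_succ]
      · simp [rerouteColor, h1, h2, h3, not_lt.mp h3]
    · simp [rerouteColor, h1, h2]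

theorem chainComparable_of_rerouteColor_eq (hkc : Function.Injective kc)
    (hminus₁ : ∀ r, MinusRow a a' r → kr r₁ < kr r)
    (hminus : ∀ r s, MinusRow a a' r → MinusRow a a' s → r < s → kr r < kr s)
    (hplus : ∀ r s, PlusRow a a' r → PlusRow a a' s → r < s → kr s < kr r)
    {p q : ℕ × ℕ} (hp : p ≠ (r₁, c₁)) (hq : q ≠ (r₁, c₁))
    (hpq : rerouteColor a a' r₁ c₁ kc p = rerouteColor a a' r₁ c₁ kc q) :
    ChainComparable kr kc p q := by
  classical
  have plus_plus : ∀ x y : ℕ × ℕ, PlusRow a a' x.1 → PlusRow a a' y.1 → kc c₁ < kc x.2 →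
      kc y.2 ≤ kc c₁ → Nat.count (PlusRow a a') x.1 + 1 = Nat.count (PlusRow a a') y.1 →
      ChainComparable kr kc x y := by
    intro x y hx hy hu hv h
    have hxy : x.1 < y.1 := by
      by_contra! hle
      have h1 := Nat.count_monotone (PlusRow a a') hle
      omega
    exact Or.inr (Or.inr ⟨hv.trans_lt hu, hplus _ _ hx hy hxy⟩)
  have minus_minus : ∀ x y : ℕ × ℕ, MinusRow a a' x.1 → MinusRow a a' y.1 → kc x.2 < kc c₁ →
      kc c₁ ≤ kc y.2 → Nat.count (MinusRow a a') x.1 + 1 = Nat.count (MinusRow a a') y.1 →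
      ChainComparable kr kc x y := by
    intro x y hx hy hu hv h
    have hxy : x.1 < y.1 := by
      by_contra! hle
      have h1 := Nat.count_monotone (MinusRow a a') hle
      omega
    exact Or.inr (Or.inl ⟨hu.trans_le hv, hminus _ _ hx hy hxy⟩)
  have center_minus : ∀ x y : ℕ × ℕ, x ≠ (r₁, c₁) → x.1 = r₁ → kc x.2 ≤ kc c₁ →
      MinusRow a a' y.1 → kc c₁ ≤ kc y.2 → ChainComparable kr kc x y := by
    intro x y hx hxr hle hy hv
    have hlt : kc x.2 < kc c₁ := lt_of_le_of_ne hle fun e => hx (Prod.ext hxr (hkc e))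
    exact Or.inr (Or.inl ⟨hlt.trans_le hv, hxr ▸ hminus₁ _ hy⟩)
  rcases rerouteColor_cases a a' r₁ c₁ kc p with
    ⟨hp1, hp2, hp3⟩ | ⟨hp1, hp2, -, hp3⟩ | ⟨hp1, hp2, hp3⟩ | ⟨hp1, hp2, hp3⟩ | ⟨hp1, hp2, hp3⟩ |
    ⟨hp1, hp2, hp3⟩ <;>
  rcases rerouteColor_cases a a' r₁ c₁ kc q with
    ⟨hq1, hq2, hq3⟩ | ⟨hq1, hq2, -, hq3⟩ | ⟨hq1, hq2, hq3⟩ | ⟨hq1, hq2, hq3⟩ | ⟨hq1, hq2, hq3⟩ |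
    ⟨hq1, hq2, hq3⟩ <;>
  rw [hp3, hq3, Prod.mk.injEq] at hpq <;>
  obtain ⟨hpq1, hpq2⟩ := hpq <;>
  first
  | omega
  | exact Or.inl hpq2
  | exact Or.inl (hp1.trans hq1.symm)
  | exact Or.inl (Nat.count_injective hp1 hq1 hpq2)
  | exact Or.inl (Nat.count_injective hp1 hq1 (Nat.succ_injective hpq2))
  | exact plus_plus _ _ hp1 hq1 hp2 hq2 hpq2
  | exact (plus_plus _ _ hq1 hp1 hq2 hp2 hpq2.symm).symm
  | exact minus_minus _ _ hp1 hq1 hp2 hq2 hpq2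
  | exact (minus_minus _ _ hq1 hp1 hq2 hp2 hpq2.symm).symm
  | exact center_minus _ _ hp hp1 hp2 hq1 hq2
  | exact (center_minus _ _ hq hq1 hq2 hp1 hp2).symm

end Rerouting

section RowLemma

variable {a b a' b' : ℕ → ℕ} {r₁ c₁ : ℕ} {kr kc : ℕ → ℤ}

/-- The last index before `k` and the first index after `k` at which two partial sums differ. -/
theorem exists_minusRow_plusRow (h : ConjugatePair a b) (h' : ConjugatePair a' b')
    (hcard : (cells a b).card = (cells a' b').card + 1) (hr₁ : PlusRow a a' r₁) {k : ℕ}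
    (hk : r₁ < k) (hk0 : psum a k = psum a' k) :
    ∃ s t, MinusRow a a' s ∧ PlusRow a a' t ∧ s < k ∧ k ≤ t ∧
      ∀ i, s < i → i ≤ t → psum a i = psum a' i := by
  classical
  have hex : ∃ i, k < i ∧ psum a i ≠ psum a' i := by
    refine ⟨max (b 0) (b' 0) + k + 1, by omega, ?_⟩
    rw [psum_eq_card_cells h (by omega), psum_eq_card_cells h' (by omega)]
    omega
  obtain ⟨hi1, hi2⟩ := Nat.find_spec hex
  have hmin : ∀ i, k < i → i < Nat.find hex → psum a i = psum a' i := fun i h1 h2 => by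
    have := Nat.find_min hex h2
    tauto
  set i₀ := Nat.find hex
  set s := Nat.findGreatest (fun i => psum a i ≠ psum a' i) k with hs
  have hsP : psum a s ≠ psum a' s :=
    Nat.findGreatest_spec (P := fun i => psum a i ≠ psum a' i) (Nat.succ_le_of_lt hk) hr₁.2
  have hsk : s ≤ k := Nat.findGreatest_le k
  have hgt : ∀ i, s < i → i ≤ k → psum a i = psum a' i := fun i h1 h2 =>
    not_not.mp (Nat.findGreatest_is_greatest h1 h2)
  have hsk' : s < k := lt_of_le_of_ne hsk fun e => hsP (e ▸ hk0)
  have hz : ∀ i, s < i → i ≤ i₀ - 1 → psum a i = psum a' i := fun i h1 h2 => by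
    rcases le_or_gt i k with h3 | h3
    · exact hgt i h1 h3
    · exact hmin i h3 (by omega)
  refine ⟨s, i₀ - 1, ⟨hsP, hz _ (by omega) (by omega)⟩, ⟨hz _ (by omega) (by omega), ?_⟩, hsk',
    by omega, hz⟩
  rwa [Nat.sub_add_cancel (by omega)]

theorem lt_of_plusRow (h : ConjugatePair a b) (h' : ConjugatePair a' b')
    (hcard : (cells a b).card = (cells a' b').card + 1)
    (hc₁ : ∀ c ≤ c₁, psum b c = psum b' c) {r : ℕ} (hr : PlusRow a a' r) : c₁ < a r := by
  by_contra! hle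
  exact psum_column_ne_row h h' hcard hr.1 (hc₁ _ hle)

/-- Row `t` has more cells left of the center than row `s`. -/
theorem card_lt_card_left_cells (h : ConjugatePair a b) (h' : ConjugatePair a' b')
    (hcard : (cells a b).card = (cells a' b').card + 1)
    (hc₁ : ∀ c ≤ c₁, psum b c = psum b' c)
    (hcol : ∀ c, c₁ < c → psum b c ≠ psum b' c → psum b (c + 1) ≠ psum b' (c + 1) →
      kc c₁ < kc c)
    {s t : ℕ} (ht : PlusRow a a' t) (hst : s < t)
    (hz : ∀ i, s < i → i ≤ t → psum a i = psum a' i) :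
    ((cells a b).filter fun p => p.1 = s ∧ kc p.2 < kc c₁).card <
      ((cells a b).filter fun p => p.1 = t ∧ kc p.2 ≤ kc c₁).card := by
  classical
  have hct := lt_of_plusRow h h' hcard hc₁ ht
  set L := (cells a b).filter fun p => p.1 = s ∧ kc p.2 < kc c₁ with hL
  have hinj : Set.InjOn (fun p : ℕ × ℕ => (t, p.2)) L := by
    rintro ⟨x, y⟩ hp ⟨x', y'⟩ hq hpq
    simp only [hL, Finset.coe_filter, Set.mem_ofPred_eq] at hp hq
    simp only [Prod.mk.injEq, true_and] at hpq
    rw [hp.2.1, hq.2.1, hpq]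
  rw [← Finset.card_image_of_injOn hinj, ← Nat.succ_le_iff, Nat.succ_eq_add_one,
    ← Finset.card_insert_of_notMem (a := (t, c₁))]
  · refine Finset.card_le_card fun p hp => ?_
    rcases Finset.mem_insert.mp hp with rfl | hp
    · simp [mem_cells h, hct]
    · obtain ⟨⟨x, y⟩, hq, rfl⟩ := Finset.mem_image.mp hp
      simp only [hL, Finset.mem_filter, mem_cells h] at hq
      obtain ⟨hq1, rfl, hq3⟩ := hq
      simp only [Finset.mem_filter, mem_cells h, hq3.le, and_true]
      by_contra! hle
      refine hq3.not_gt (hcol y (hct.trans_le hle) ?_ ?_)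
      · exact psum_column_ne_between h h' hcard hst hz hle hq1.le
      · exact psum_column_ne_between h h' hcard hst hz (hle.trans (Nat.le_succ _)) hq1
  · intro hp
    obtain ⟨⟨x, y⟩, hq, he⟩ := Finset.mem_image.mp hp
    simp only [hL, Finset.mem_filter] at hq
    simp only [Prod.mk.injEq, true_and] at he
    exact (he ▸ hq.2.2).ne rfl

open Classical in
theorem count_plusRow_eq_of_psum_eq {s t i : ℕ} (hi : s < i) (hit : i ≤ t)
    (hz : ∀ i, s < i → i ≤ t → psum a i = psum a' i) :
    Nat.count (PlusRow a a') i = Nat.count (PlusRow a a') t := by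
  induction t, hit using Nat.le_induction with
  | base => rfl
  | succ t hit ih =>
    rw [ih fun i h1 h2 => hz i h1 (h2.trans (Nat.le_succ _)), Nat.count_succ, if_neg, add_zero]
    exact fun hp => hp.2 (hz _ (by omega) le_rfl)

open Classical in
theorem exists_colors (r : ℕ) (hr : psum a r = psum a' r) :
    ∃ colors : Finset (ℕ × ℕ), colors.card ≤ r ∧
      (∀ i < Nat.count (PlusRow a a') r, (0, i) ∈ colors) ∧
      (∀ i, 0 < i → i ≤ Nat.count (PlusRow a a') r → (1, i) ∈ colors) ∧
      ∀ i < r, ¬ PlusRow a a' i → ¬ MinusRow a a' i → (2, i) ∈ colors := by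
  have h1 := count_plusRow_eq (a := a) (a' := a') r
  have h2 := count_add_count_add_count (a := a) (a' := a') r
  rw [if_pos hr, add_zero] at h1
  set t := Nat.count (PlusRow a a') r
  refine ⟨(Finset.range t).image (fun i => (0, i)) ∪ ((Finset.Icc 1 t).image (fun i => (1, i)) ∪
    ((Finset.range r).filter fun i => ¬ PlusRow a a' i ∧ ¬ MinusRow a a' i).image
      fun i => (2, i)), ?_, ?_, ?_, ?_⟩
  · refine (Finset.card_union_le _ _).trans ((Nat.add_le_add Finset.card_image_le
      ((Finset.card_union_le _ _).trans
        (Nat.add_le_add Finset.card_image_le Finset.card_image_le))).trans ?_)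
    rw [← Nat.count_eq_card_filter_range, Finset.card_range, Nat.card_Icc]
    omega
  · intro i hi
    simp [hi]
  · intro i hi hit
    simp [hit, Nat.succ_le_of_lt hi]
  · intro i hi hp hm
    simp [hi, hp, hm]

theorem exists_chain_cover (h : ConjugatePair a b) (h' : ConjugatePair a' b')
    (hcard : (cells a b).card = (cells a' b').card + 1)
    (hle : ∀ r, psum a' r ≤ psum a r)
    (hr₁ : PlusRow a a' r₁) (hr₁' : ∀ r ≤ r₁, psum a r = psum a' r)
    (hc₁ : ∀ c ≤ c₁, psum b c = psum b' c) (hkc : Function.Injective kc)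
    (hminus₁ : ∀ r, MinusRow a a' r → kr r₁ < kr r)
    (hminus : ∀ r s, MinusRow a a' r → MinusRow a a' s → r < s → kr r < kr s)
    (hplus : ∀ r s, PlusRow a a' r → PlusRow a a' s → r < s → kr s < kr r)
    (hcol : ∀ c, c₁ < c → psum b c ≠ psum b' c → psum b (c + 1) ≠ psum b' (c + 1) →
      kc c₁ < kc c) (k : ℕ) :
    ∃ (S : Finset (ℕ × ℕ)) (color : ℕ × ℕ → ℕ × ℕ) (colors : Finset (ℕ × ℕ)),
      S ⊆ (cells a b).erase (r₁, c₁) ∧ colors.card ≤ k ∧ (∀ p ∈ S, color p ∈ colors) ∧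
      psum a' k ≤ S.card ∧ ∀ p ∈ S, ∀ q ∈ S, color p = color q → ChainComparable kr kc p q := by
  classical
  set F := (cells a b).filter fun p => p.1 < k with hF
  have hFcard : F.card = psum a k := card_cells_rows h k
  by_cases hk : psum a k = psum a' k ∧ r₁ < k
  · obtain ⟨hk0, hk⟩ := hk
    obtain ⟨s, t, hs, ht, hsk, hkt, hz⟩ := exists_minusRow_plusRow h h' hcard hr₁ hk hk0
    have hlt := card_lt_card_left_cells h h' hcard hc₁ hcol ht (hsk.trans_le hkt) hz
    obtain ⟨colors, hcolors, hcolors0, hcolors1, hcolors2⟩ := exists_colors k hk0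
    set L := (cells a b).filter fun p => p.1 = s ∧ kc p.2 < kc c₁ with hL
    set L' := (cells a b).filter fun p => p.1 = t ∧ kc p.2 ≤ kc c₁ with hL'
    have hcount := count_plusRow_eq (a := a) (a' := a') k
    rw [if_pos hk0, add_zero] at hcount
    have hpos : 0 < Nat.count (PlusRow a a') k :=
      (Nat.zero_le _).trans_lt (Nat.count_strict_mono hr₁ hk)
    have hne : ∀ p ∈ (F \ L).erase (r₁, c₁) ∪ L', p ≠ (r₁, c₁) := by
      intro p hp
      rcases Finset.mem_union.mp hp with hp | hp
      · exact Finset.ne_of_mem_erase hp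
      · rintro rfl
        simp only [hL', Finset.mem_filter] at hp
        omega
    refine ⟨(F \ L).erase (r₁, c₁) ∪ L', rerouteColor a a' r₁ c₁ kc, colors, ?_, hcolors, ?_, ?_,
      fun p hp q hq => chainComparable_of_rerouteColor_eq hkc hminus₁ hminus hplus (hne p hp)
        (hne q hq)⟩
    · intro p hp
      refine Finset.mem_erase.mpr ⟨hne p hp, ?_⟩
      rcases Finset.mem_union.mp hp with hp | hp
      · exact (Finset.mem_filter.mp (Finset.mem_sdiff.mp (Finset.mem_of_mem_erase hp)).1).1
      · exact (Finset.mem_filter.mp hp).1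
    · intro p hp
      have hp' : p.1 < k ∧ ¬ (p.1 = s ∧ kc p.2 < kc c₁) ∨ p.1 = t ∧ kc p.2 ≤ kc c₁ := by
        rcases Finset.mem_union.mp hp with hp | hp
        · have hp := Finset.mem_sdiff.mp (Finset.mem_of_mem_erase hp)
          simp only [hL, hF, Finset.mem_filter] at hp
          tauto
        · exact Or.inr (Finset.mem_filter.mp hp).2
      rcases rerouteColor_cases a a' r₁ c₁ kc p with
        ⟨hp1, hp2, hp3⟩ | ⟨hp1, hp2, hne₁, hp3⟩ | ⟨hp1, hp2, hp3⟩ | ⟨hp1, hp2, hp3⟩ |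
        ⟨hp1, hp2, hp3⟩ | ⟨hp1, hp2, hp3⟩ <;> rw [hp3]
      · rcases hp' with ⟨hp', -⟩ | ⟨-, hp'⟩
        · exact hcolors1 _ (Nat.succ_pos _) (Nat.count_strict_mono hp1 hp')
        · exact absurd hp' hp2.not_ge
      · have hr : r₁ < p.1 := lt_of_le_of_ne
          (not_lt.mp fun hlt => hp1.2 (hr₁' _ hlt)) (Ne.symm hne₁)
        refine hcolors1 _ ((Nat.zero_le _).trans_lt (Nat.count_strict_mono hr₁ hr)) ?_
        rcases hp' with ⟨hp', -⟩ | ⟨hp', -⟩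
        · exact Nat.count_monotone _ hp'.le
        · rw [hp', count_plusRow_eq_of_psum_eq hsk hkt hz]
      · exact hcolors0 _ hpos
      · rcases hp' with ⟨hp', hp''⟩ | ⟨hp', -⟩
        · have hps : p.1 < s := by
            by_contra! hsp
            have hsp' : s < p.1 := lt_of_le_of_ne hsp fun e => hp'' ⟨e.symm, hp2⟩
            exact hp1.1 (hz _ hsp' (hp'.le.trans hkt))
          have h1 := Nat.count_strict_mono hp1 hps
          have h2 := Nat.count_strict_mono hs hsk
          exact hcolors0 _ (by omega)
        · rw [hp'] at hp1
          exact absurd ht.1 hp1.1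
      · rcases hp' with ⟨hp', -⟩ | ⟨hp', -⟩
        · have h1 := Nat.count_strict_mono hp1 hp'
          exact hcolors0 _ (by omega)
        · rw [hp'] at hp1
          exact absurd ht.1 hp1.1
      · rcases hp' with ⟨hp', -⟩ | ⟨hp', -⟩
        · exact hcolors2 _ hp' hp1 hp2
        · rw [hp'] at hp1
          exact absurd ht hp1
    · have hdisj : Disjoint ((F \ L).erase (r₁, c₁)) L' := by
        rw [Finset.disjoint_left]
        intro p hp hp'
        have h1 := (Finset.mem_filter.mp (Finset.mem_sdiff.mp (Finset.mem_of_mem_erase hp)).1).2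
        have h2 := (Finset.mem_filter.mp hp').2.1
        omega
      have hLF : L ⊆ F := fun p hp => by
        simp only [hL, hF, Finset.mem_filter] at hp ⊢
        exact ⟨hp.1, by omega⟩
      have h1 := Finset.card_le_card hLF
      have h2 := Finset.card_sdiff_of_subset hLF
      have h3 := Finset.pred_card_le_card_erase (s := F \ L) (a := (r₁, c₁))
      rw [Finset.card_union_of_disjoint hdisj]
      omega
  · refine ⟨F.erase (r₁, c₁), fun p => (0, p.1), (Finset.range k).image fun i => (0, i),
      Finset.erase_subset_erase _ (Finset.filter_subset _ _),
      Finset.card_image_le.trans (Finset.card_range k).le, fun p hp => ?_, ?_,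
      fun p _ q _ hpq => Or.inl (Prod.ext_iff.mp hpq).2⟩
    · have := (Finset.mem_filter.mp (Finset.mem_of_mem_erase hp)).2
      simpa using this
    · by_cases hkr : k ≤ r₁
      · rw [Finset.erase_eq_of_notMem, hFcard, hr₁' k hkr]
        simp [hF, hkr]
      · have h1 := Finset.pred_card_le_card_erase (s := F) (a := (r₁, c₁))
        have h2 := hle k
        have h3 : psum a k ≠ psum a' k := fun e => hk ⟨e, not_le.mp hkr⟩
        omega

end RowLemma

/-- The permutation `π` is in the same relative order as the points of `P`, listed by `e`, with
horizontal coordinates `pos` and vertical coordinates `val`. -/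
structure IsPlot {X α β : Type*} [LT α] [LT β] (pos : X → α) (val : X → β) (P : Finset X) {n : ℕ}
    (π : Equiv.Perm (Fin n)) (e : Fin n → X) : Prop where
  injective : Function.Injective e
  mem_iff : ∀ x, x ∈ P ↔ ∃ i, e i = x
  pos_lt : ∀ i j, i < j ↔ pos (e i) < pos (e j)
  val_lt : ∀ i j, π i < π j ↔ val (e i) < val (e j)

section Plot

theorem exists_isPlot {X α β : Type*} [LinearOrder α] [LinearOrder β] {pos : X → α} {val : X → β}
    (hpos : Function.Injective pos) (hval : Function.Injective val) (P : Finset X) :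
    ∃ (π : Equiv.Perm (Fin P.card)) (e : Fin P.card → X), IsPlot pos val P π e := by
  classical
  have hposP : (P.image pos).card = P.card := Finset.card_image_of_injective P hpos
  have hvalP : (P.image val).card = P.card := Finset.card_image_of_injective P hval
  let f := (P.image pos).orderIsoOfFin hposP
  let g := (P.image val).orderIsoOfFin hvalP
  have hex : ∀ i, ∃ x, x ∈ P ∧ pos x = f i := fun i => Finset.mem_image.mp (f i).2
  choose e heP hef using hex
  have he : Function.Injective e := fun i j hij =>
    f.injective (Subtype.ext ((hef i).symm.trans ((congrArg pos hij).trans (hef j))))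
  have himage : Finset.univ.image e = P :=
    Finset.eq_of_subset_of_card_le (fun x hx => by
      obtain ⟨i, -, rfl⟩ := Finset.mem_image.mp hx
      exact heP i) (by rw [Finset.card_image_of_injective _ he, Finset.card_univ, Fintype.card_fin])
  let v : Fin P.card → Fin P.card := fun i => g.symm ⟨val (e i), Finset.mem_image_of_mem val (heP i)⟩
  have hv : Function.Injective v := fun i j hij =>
    he (hval (Subtype.ext_iff.mp (g.symm.injective hij)))
  refine ⟨Equiv.ofBijective v (Finite.injective_iff_bijective.mp hv), e, he, fun x => ?_,
    fun i j => ?_, fun i j => ?_⟩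
  · exact (Finset.ext_iff.mp himage x).symm.trans (by simp)
  · rw [hef, hef, Subtype.coe_lt_coe, f.lt_iff_lt]
  · change v i < v j ↔ _
    rw [g.symm.lt_iff_lt, Subtype.mk_lt_mk]

variable {X α β : Type*} [LinearOrder α] [LinearOrder β] {pos : X → α} {val : X → β}
  {P Q : Finset X} {m n : ℕ} {σ : Equiv.Perm (Fin m)} {π : Equiv.Perm (Fin n)}
  {d : Fin m → X} {e : Fin n → X}

theorem IsPlot.involved (hσ : IsPlot pos val P σ d) (hπ : IsPlot pos val Q π e) (hPQ : P ⊆ Q) :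
    Involved σ π := by
  have hex : ∀ i, ∃ j, e j = d i := fun i => (hπ.mem_iff _).mp (hPQ ((hσ.mem_iff _).mpr ⟨i, rfl⟩))
  choose f hf using hex
  refine ⟨f, fun i j hij => ?_, fun i j => ?_⟩
  · rw [hπ.pos_lt, hf, hf, ← hσ.pos_lt]
    exact hij
  · rw [hσ.val_lt, hπ.val_lt, hf, hf]

theorem IsPlot.card_le_maxUnion (hπ : IsPlot pos val P π e) {R : Fin n → Fin n → Prop} {k : ℕ}
    {γ : Type*} {S : Finset X} (hS : S ⊆ P) {colors : Finset γ} (hk : colors.card ≤ k) {c : X → γ}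
    (hc : ∀ x ∈ S, c x ∈ colors)
    (hR : ∀ i j, i < j → e i ∈ S → e j ∈ S → c (e i) = c (e j) → R i j) :
    S.card ≤ maxUnion R k := by
  classical
  have hcard : (Finset.univ.filter fun i => e i ∈ S).card = S.card := by
    rw [← Finset.card_image_of_injective _ hπ.injective]
    congr 1
    ext x
    simp only [Finset.mem_image, Finset.mem_filter, Finset.mem_univ, true_and]
    constructor
    · rintro ⟨i, hi, rfl⟩
      exact hi
    · intro hx
      obtain ⟨i, rfl⟩ := (hπ.mem_iff x).mp (hS hx)
      exact ⟨i, hx, rfl⟩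
  rw [← hcard]
  refine _root_.card_le_maxUnion _ colors hk (fun i => c (e i)) (fun i hi => ?_)
    fun i hi j hj hij hc => ?_
  · exact hc _ (Finset.mem_filter.mp hi).2
  · exact hR i j hij (Finset.mem_filter.mp hi).2 (Finset.mem_filter.mp hj).2 hc

end Plot

section CellPlot

/-- Columns are placed from left to right by `kc`, each of them decreasing with respect to `kr`. -/
def cellPos (kr kc : ℕ → ℤ) (p : ℕ × ℕ) : ℤ ×ₗ ℤ := toLex (kc p.2, -kr p.1)

/-- Rows are stacked from bottom to top by `kr`, each of them increasing with respect to `kc`. -/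
def cellVal (kr kc : ℕ → ℤ) (p : ℕ × ℕ) : ℤ ×ₗ ℤ := toLex (kr p.1, kc p.2)

variable {kr kc : ℕ → ℤ}

theorem cellPos_injective (hkr : Function.Injective kr) (hkc : Function.Injective kc) :
    Function.Injective (cellPos kr kc) := by
  intro p q hpq
  have h := Prod.ext_iff.mp (toLex.injective hpq)
  exact Prod.ext (hkr (neg_injective h.2)) (hkc h.1)

theorem cellVal_injective (hkr : Function.Injective kr) (hkc : Function.Injective kc) :
    Function.Injective (cellVal kr kc) := by
  intro p q hpq
  have h := Prod.ext_iff.mp (toLex.injective hpq)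
  exact Prod.ext (hkr h.1) (hkc h.2)

theorem ChainComparable.cellVal_lt {p q : ℕ × ℕ} (h : ChainComparable kr kc p q)
    (hpq : cellPos kr kc p < cellPos kr kc q) : cellVal kr kc p < cellVal kr kc q := by
  simp only [cellPos, cellVal, Prod.Lex.toLex_lt_toLex] at hpq ⊢
  rcases h with h | h | h
  · rw [h] at hpq ⊢
    omega
  · omega
  · omega

theorem ChainComparable.cellVal_gt {p q : ℕ × ℕ}
    (h : ChainComparable kc (fun r => -kr r) p.swap q.swap)
    (hpq : cellPos kr kc p < cellPos kr kc q) : cellVal kr kc q < cellVal kr kc p := by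
  simp only [cellPos, cellVal, Prod.Lex.toLex_lt_toLex] at hpq ⊢
  rcases h with h | h | h
  · simp only [Prod.fst_swap] at h
    rw [h] at hpq ⊢
    omega
  · simp only [Prod.fst_swap, Prod.snd_swap] at h
    omega
  · simp only [Prod.fst_swap, Prod.snd_swap] at h
    omega

theorem IsPlot.hasShape {P : Finset (ℕ × ℕ)} {n : ℕ} {π : Equiv.Perm (Fin n)} {e : Fin n → ℕ × ℕ}
    (hπ : IsPlot (cellPos kr kc) (cellVal kr kc) P π e) {p : YPartition}
    (hn : (cells p.parts (conjParts p)).card = n)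
    (hI : ∀ k, ∃ (S : Finset (ℕ × ℕ)) (color : ℕ × ℕ → ℕ × ℕ) (colors : Finset (ℕ × ℕ)),
      S ⊆ P ∧ colors.card ≤ k ∧ (∀ p ∈ S, color p ∈ colors) ∧ psum p.parts k ≤ S.card ∧
      ∀ p ∈ S, ∀ q ∈ S, color p = color q → ChainComparable kr kc p q)
    (hD : ∀ k, ∃ (S : Finset (ℕ × ℕ)) (color : ℕ × ℕ → ℕ × ℕ) (colors : Finset (ℕ × ℕ)),
      S ⊆ P.image Prod.swap ∧ colors.card ≤ k ∧ (∀ p ∈ S, color p ∈ colors) ∧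
      psum (conjParts p) k ≤ S.card ∧
      ∀ p ∈ S, ∀ q ∈ S, color p = color q → ChainComparable kc (fun r => -kr r) p q) :
    HasShape π p := by
  refine hasShape_of_le hn (fun k => ?_) fun k => ?_
  · obtain ⟨S, color, colors, hS, hk, hc, hcard, h⟩ := hI k
    exact hcard.trans (hπ.card_le_maxUnion hS hk hc fun i j hij hi hj hc =>
      (hπ.val_lt i j).mpr ((h _ hi _ hj hc).cellVal_lt ((hπ.pos_lt i j).mp hij)))
  · obtain ⟨S, color, colors, hS, hk, hc, hcard, h⟩ := hD k
    rw [← Finset.card_image_of_injective S Prod.swap_injective] at hcard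
    have hmem : ∀ x ∈ S.image Prod.swap, x.swap ∈ S := fun x hx => by
      obtain ⟨y, hy, rfl⟩ := Finset.mem_image.mp hx
      rwa [Prod.swap_swap]
    refine hcard.trans (hπ.card_le_maxUnion (fun x hx => ?_) hk (c := fun x => color x.swap)
      (fun x hx => hc _ (hmem x hx)) fun i j hij hi hj hc =>
      (hπ.val_lt j i).mpr ((h _ (hmem _ hi) _ (hmem _ hj) hc).cellVal_gt ((hπ.pos_lt i j).mp hij)))
    obtain ⟨y, hy, hyx⟩ := Finset.mem_image.mp (hS (hmem x hx))
    rwa [← Prod.swap_injective hyx]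

end CellPlot

section OneStep

variable {a b a' b' : ℕ → ℕ}

theorem image_swap_cells (h : ConjugatePair a b) : (cells a b).image Prod.swap = cells b a := by
  ext ⟨x, y⟩
  simp only [Finset.mem_image, mem_cells h, mem_cells h.symm, Prod.exists, Prod.swap_prod_mk,
    Prod.mk.injEq]
  constructor
  · rintro ⟨r, c, hrc, rfl, rfl⟩
    exact (h _ _).mp hrc
  · exact fun hxy => ⟨y, x, (h _ _).mpr hxy, rfl, rfl⟩

theorem exists_chain_cover_rows (h : ConjugatePair a b) (kr kc : ℕ → ℤ) (k : ℕ) :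
    ∃ (S : Finset (ℕ × ℕ)) (color : ℕ × ℕ → ℕ × ℕ) (colors : Finset (ℕ × ℕ)),
      S ⊆ cells a b ∧ colors.card ≤ k ∧ (∀ p ∈ S, color p ∈ colors) ∧ psum a k ≤ S.card ∧
      ∀ p ∈ S, ∀ q ∈ S, color p = color q → ChainComparable kr kc p q := by
  refine ⟨(cells a b).filter fun p => p.1 < k, fun p => (0, p.1),
    (Finset.range k).image fun i => (0, i), Finset.filter_subset _ _,
    Finset.card_image_le.trans (Finset.card_range k).le, fun p hp => ?_, (card_cells_rows h k).ge,
    fun p _ q _ hpq => Or.inl (Prod.ext_iff.mp hpq).2⟩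
  simpa using (Finset.mem_filter.mp hp).2

theorem exists_first_plusRow (h : ∃ i, psum a i ≠ psum a' i) :
    ∃ r, PlusRow a a' r ∧ ∀ i ≤ r, psum a i = psum a' i := by
  classical
  have hspec := Nat.find_spec h
  have hmin : ∀ i < Nat.find h, psum a i = psum a' i := fun i hi => not_not.mp (Nat.find_min h hi)
  obtain ⟨r, hr⟩ := Nat.exists_eq_succ_of_ne_zero fun h0 : Nat.find h = 0 =>
    hspec (by rw [h0, psum_zero, psum_zero])
  rw [hr] at hspec hmin
  exact ⟨r, ⟨hmin r (Nat.lt_succ_self r), hspec⟩, fun i hi => hmin i (Nat.lt_succ_of_le hi)⟩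

theorem exists_psum_ne (h : ConjugatePair a b) (h' : ConjugatePair a' b')
    (hcard : (cells a b).card = (cells a' b').card + 1) : ∃ i, psum a i ≠ psum a' i := by
  refine ⟨max (b 0) (b' 0), ?_⟩
  rw [psum_eq_card_cells h (le_max_left _ _), psum_eq_card_cells h' (le_max_right _ _)]
  omega

open Classical in
/-- The vertical order of the rows: reversed, except that the shortened rows go on top in their
original order. -/
noncomputable def rowKey (a a' : ℕ → ℕ) (r : ℕ) : ℤ := if MinusRow a a' r then r else -(r + 1)

open Classical in
/-- The horizontal order of the columns: the lengthened columns go first in reversed order. -/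
noncomputable def columnKey (b b' : ℕ → ℕ) (c : ℕ) : ℤ := if PlusRow b b' c then -(c + 1) else c

theorem rowKey_of_minusRow {r : ℕ} (hr : MinusRow a a' r) : rowKey a a' r = r := if_pos hr

theorem rowKey_of_not_minusRow {r : ℕ} (hr : ¬ MinusRow a a' r) : rowKey a a' r = -(r + 1) :=
  if_neg hr

theorem columnKey_of_plusRow {c : ℕ} (hc : PlusRow b b' c) : columnKey b b' c = -(c + 1) :=
  if_pos hc

theorem columnKey_of_not_plusRow {c : ℕ} (hc : ¬ PlusRow b b' c) : columnKey b b' c = c :=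
  if_neg hc

theorem PlusRow.not_minusRow {r : ℕ} (hr : PlusRow a a' r) : ¬ MinusRow a a' r :=
  fun h => h.1 hr.1

theorem rowKey_injective (a a' : ℕ → ℕ) : Function.Injective (rowKey a a') := by
  intro r s hrs
  unfold rowKey at hrs
  split_ifs at hrs <;> omega

theorem columnKey_injective (b b' : ℕ → ℕ) : Function.Injective (columnKey b b') := by
  intro r s hrs
  unfold columnKey at hrs
  split_ifs at hrs <;> omega

theorem DoublyDominates.exists_involved {μ ν : YPartition} (hd : DoublyDominates μ ν)
    (hcard : (cells μ.parts (conjParts μ)).card = (cells ν.parts (conjParts ν)).card + 1) :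
    ∃ π σ : SPerm, HasShapeS π μ ∧ HasShapeS σ ν ∧ InvolvedS σ π := by
  have h := conjugatePair_conjParts μ
  have h' := conjugatePair_conjParts ν
  obtain ⟨hle, hle'⟩ := hd
  have hcard' := hcard
  rw [card_cells_comm h, card_cells_comm h'] at hcard'
  obtain ⟨r₁, hr₁, hr₁'⟩ := exists_first_plusRow (exists_psum_ne h h' hcard)
  obtain ⟨c₁, hc₁, hc₁'⟩ := exists_first_plusRow (exists_psum_ne h.symm h'.symm hcard')
  set a := μ.parts
  set b := conjParts μ
  set a' := ν.parts
  set b' := conjParts ν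
  set kr := rowKey a a' with hkr
  set kc := columnKey b b' with hkc
  have hkr_inj : Function.Injective kr := rowKey_injective a a'
  have hkc_inj : Function.Injective kc := columnKey_injective b b'
  have hkr₁ : kr r₁ = -(r₁ + 1) := rowKey_of_not_minusRow hr₁.not_minusRow
  have hkc₁ : kc c₁ = -(c₁ + 1) := columnKey_of_plusRow hc₁
  have rows := exists_chain_cover (kr := kr) (kc := kc) h h' hcard hle hr₁ hr₁' hc₁' hkc_inj
    (fun r hr => by
      rw [hkr₁, hkr, rowKey_of_minusRow hr]
      omega)
    (fun r s hr hs hrs => by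
      rw [hkr, rowKey_of_minusRow hr, rowKey_of_minusRow hs]
      omega)
    (fun r s hr hs hrs => by
      rw [hkr, rowKey_of_not_minusRow hr.not_minusRow, rowKey_of_not_minusRow hs.not_minusRow]
      omega)
    (fun c _ hc _ => by
      rw [hkc₁, hkc, columnKey_of_not_plusRow fun hp => hc hp.1]
      omega)
  have columns := exists_chain_cover (kr := kc) (kc := fun r => -kr r) h.symm h'.symm hcard' hle'
    hc₁ hc₁' hr₁' (fun r s hrs => hkr_inj (neg_injective hrs))
    (fun c hc => by
      rw [hkc₁, hkc, columnKey_of_not_plusRow fun hp => hp.not_minusRow hc]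
      omega)
    (fun c d hc hd hcd => by
      rw [hkc, columnKey_of_not_plusRow fun hp => hp.not_minusRow hc,
        columnKey_of_not_plusRow fun hp => hp.not_minusRow hd]
      omega)
    (fun c d hc hd hcd => by
      rw [hkc, columnKey_of_plusRow hc, columnKey_of_plusRow hd]
      omega)
    (fun r hr _ hr' => by
      rw [hkr₁, hkr, rowKey_of_not_minusRow fun hm => hr' hm.2]
      omega)
  have hpos := cellPos_injective hkr_inj hkc_inj
  have hval := cellVal_injective hkr_inj hkc_inj
  obtain ⟨π, e, hπ⟩ := exists_isPlot hpos hval (cells a b)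
  obtain ⟨σ, d, hσ⟩ := exists_isPlot hpos hval ((cells a b).erase (r₁, c₁))
  have hmem : (r₁, c₁) ∈ cells a b := (mem_cells h).mpr (lt_of_plusRow h h' hcard hc₁' hr₁)
  refine ⟨⟨_, π⟩, ⟨_, σ⟩, hπ.hasShape rfl (exists_chain_cover_rows h kr kc) ?_,
    hσ.hasShape ?_ rows ?_, hσ.involved hπ (Finset.erase_subset _ _)⟩
  · rw [image_swap_cells h]
    exact exists_chain_cover_rows h.symm kc _
  · rw [Finset.card_erase_of_mem hmem, hcard, Nat.add_sub_cancel]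
  · rw [Finset.image_erase Prod.swap_injective, image_swap_cells h]
    exact columns

end OneStep

theorem IsYoungClass.mem_of_hasShape {C : Set SPerm} (hC : IsYoungClass C) {π σ : SPerm}
    {lam : YPartition} (hπ : HasShapeS π lam) (hσ : HasShapeS σ lam) (hπC : π ∈ C) : σ ∈ C := by
  rcases hC.2 lam with h | h
  · exact h σ hσ
  · exact absurd hπC (h π hπ)

theorem IsYoungClass.exists_mem_of_doublyDominates {C : Set SPerm} (hC : IsYoungClass C)
    {μ lam : YPartition} (hμ : ∃ π ∈ C, HasShapeS π μ) (hd : DoublyDominates μ lam) :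
    ∃ π ∈ C, HasShapeS π lam := by
  obtain ⟨n, hn⟩ := Nat.exists_eq_add_of_le hd.card_le
  induction n generalizing lam with
  | zero => rwa [← hd.eq_of_card_eq hn.symm]
  | succ n ih =>
    obtain ⟨ν, hμν, hνlam, hcard⟩ := hd.exists_between (by omega)
    obtain ⟨τ, hτC, hτ⟩ := ih hμν (by omega)
    obtain ⟨π, σ, hπ, hσ, hσπ⟩ := hνlam.exists_involved hcard
    exact ⟨σ, hC.1 π (hC.mem_of_hasShape hτ hπ hτC) σ hσπ, hσ⟩

theorem young_class_characterization (C : Set SPerm) :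
    IsYoungClass C ↔ ∃ D : Set YPartition,
      (∀ μ ∈ D, ∀ lam : YPartition, DoublyDominates μ lam → lam ∈ D) ∧
      C = {π : SPerm | ∃ lam ∈ D, HasShapeS π lam} := by
  constructor
  · intro hC
    refine ⟨{lam | ∃ π ∈ C, HasShapeS π lam},
      fun μ hμ lam hd => hC.exists_mem_of_doublyDominates hμ hd, ?_⟩
    ext π
    constructor
    · intro hπ
      obtain ⟨lam, hlam⟩ := exists_hasShape π.2
      exact ⟨lam, ⟨π, hπ, hlam⟩, hlam⟩
    · rintro ⟨lam, ⟨σ, hσC, hσ⟩, hπ⟩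
      exact hC.mem_of_hasShape hσ hπ hσC
  · rintro ⟨D, hD, rfl⟩
    refine ⟨?_, fun lam => ?_⟩
    · rintro π ⟨μ, hμ, hπ⟩ σ hσπ
      obtain ⟨lam, hlam⟩ := exists_hasShape σ.2
      exact ⟨lam, hD μ hμ lam (Involved.doublyDominates hσπ hlam hπ), hlam⟩
    · by_cases hlam : lam ∈ D
      · exact Or.inl fun π hπ => ⟨lam, hlam, hπ⟩
      · refine Or.inr ?_
        rintro π hπ ⟨μ, hμ, hπ'⟩
        exact hlam (HasShape.unique hπ hπ' ▸ hμ)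
end
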